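/- For every fixed pair of real numbers ε₁ > 0 and ε₂ > 0, the proportion of numerical semigroups S of genus g satisfying simultaneously (γ − ε₁)·g < m(S) < (γ + ε₁)·g and (2 − ε₂)·m(S) < F(S) < (2 + ε₂)·m(S), among all numerical semigroups of genus g, tends to 1 as g → ∞. That is, with A_g^{m,F}(ε₁,ε₂) = {S of genus g : (γ − ε₁)g < m(S) < (γ + ε₁)g and (2 − ε₂)m(S) < F(S) < (2 + ε₂)m(S)}, one has lim_{g→∞} #A_g^{m,F}(ε₁,ε₂)/n_g = 1. -/

import Mathlib

/-- A numerical semigroup: an additive submonoid of ℕ with finite complement. -/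
structure NumericalSemigroup where
  carrier : Set ℕ
  zero_mem : 0 ∈ carrier
  add_mem : ∀ ⦃a b : ℕ⦄, a ∈ carrier → b ∈ carrier → a + b ∈ carrier
  cofinite : (carrierᶜ : Set ℕ).Finite

namespace NumericalSemigroup

/-- The genus: the number of gaps. -/
noncomputable def genus (S : NumericalSemigroup) : ℕ := S.carrierᶜ.ncard

/-- The multiplicity: the smallest nonzero element. -/
noncomputable def multiplicity (S : NumericalSemigroup) : ℕ :=
  sInf {n : ℕ | n ∈ S.carrier ∧ n ≠ 0}

/-- The Frobenius number: the largest gap. -/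
noncomputable def frobenius (S : NumericalSemigroup) : ℕ := sSup S.carrierᶜ

/-- The left elements: the elements of `S` smaller than the Frobenius number. -/
def leftElements (S : NumericalSemigroup) : Set ℕ :=
  {s : ℕ | s ∈ S.carrier ∧ s < S.frobenius}

end NumericalSemigroup

/-- The gcd of a set of natural numbers: the common divisor that is divisible by
every common divisor (so `setGcd ∅ = 0`). -/
noncomputable def setGcd (A : Set ℕ) : ℕ :=
  sInf {d : ℕ | (∀ a ∈ A, d ∣ a) ∧ ∀ e : ℕ, (∀ a ∈ A, e ∣ a) → e ∣ d}

/-- The constant γ = (5 + √5)/10. -/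
noncomputable def gamma : ℝ := (5 + Real.sqrt 5) / 10

/-- `S` belongs to an infinite chain in the semigroup tree. -/
def InInfiniteChain (S : NumericalSemigroup) : Prop :=
  ∃ f : ℕ → NumericalSemigroup, f 0 = S ∧
    ∀ i : ℕ, (f (i + 1)).carrier ≠ Set.univ ∧
      (f i).carrier = (f (i + 1)).carrier ∪ {(f (i + 1)).frobenius}

/-- Summing a product of successive weights over a family of sequences: if, whatever the past,
the weights of the `t`-th step sum to at most `c t`, the total weight is at most `∏ c t`. -/
theorem sum_prod_le_prod_of_step {σ : Type*} [Inhabited σ] (A : ℕ → Finset σ)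
    (q : ℕ → (ℕ → σ) → ℝ) (c : ℕ → ℝ) (hq : ∀ t f, 0 ≤ q t f)
    (hdep : ∀ t f g, (∀ j ≤ t, f j = g j) → q t f = q t g) (n : ℕ)
    (hc : ∀ t < n, ∀ f : ℕ → σ, ∑ s ∈ A t, q t (Function.update f t s) ≤ c t)
    (X : Finset (ℕ → σ)) (hA : ∀ f ∈ X, ∀ t < n, f t ∈ A t)
    (hinj : ∀ f ∈ X, ∀ g ∈ X, (∀ t < n, f t = g t) → f = g) :
    ∑ f ∈ X, ∏ t ∈ Finset.range n, q t f ≤ ∏ t ∈ Finset.range n, c t := by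
  classical
  induction n generalizing X with
  | zero =>
    have : X.card ≤ 1 := Finset.card_le_one.2 fun f hf g hg => hinj f hf g hg (by simp)
    simpa using this
  | succ n ih =>
    set τ : (ℕ → σ) → ℕ → σ := fun f t => if t < n then f t else default with hτ
    have hcn : 0 ≤ c n := (Finset.sum_nonneg fun s _ => hq _ _).trans (hc n (by omega) default)
    have hprod : ∀ f, ∏ t ∈ Finset.range n, q t (τ f) = ∏ t ∈ Finset.range n, q t f := by
      intro f
      refine Finset.prod_congr rfl fun t ht => hdep _ _ _ fun j hj => ?_
      have := Finset.mem_range.1 ht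
      simp only [hτ]
      rw [if_pos (by omega)]
    rw [← Finset.sum_fiberwise_of_maps_to (g := τ) (t := X.image τ)
      (fun f hf => Finset.mem_image_of_mem _ hf), Finset.prod_range_succ]
    have key : ∀ g ∈ X.image τ,
        ∑ f ∈ X with τ f = g, ∏ t ∈ Finset.range (n + 1), q t f ≤
          (∏ t ∈ Finset.range n, q t g) * c n := by
      intro g _
      have h1 : ∀ f ∈ X.filter (fun f => τ f = g), ∏ t ∈ Finset.range (n + 1), q t f =
          (∏ t ∈ Finset.range n, q t g) * q n (Function.update g n (f n)) := by
        intro f hf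
        have hfg := (Finset.mem_filter.1 hf).2
        rw [Finset.prod_range_succ, ← hprod f, hfg]
        congr 1
        refine hdep _ _ _ fun j hj => ?_
        rcases eq_or_lt_of_le hj with rfl | hj
        · simp
        · rw [Function.update_of_ne hj.ne, ← hfg]
          simp [hτ, hj]
      rw [Finset.sum_congr rfl h1, ← Finset.mul_sum]
      refine mul_le_mul_of_nonneg_left ?_ (Finset.prod_nonneg fun _ _ => hq _ _)
      refine le_trans ?_ (hc n (by omega) g)
      have hi : Set.InjOn (fun f : ℕ → σ => f n) (X.filter (fun f => τ f = g)) := by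
        intro f hf f' hf' hff
        simp only [Finset.coe_filter, Set.mem_ofPred_eq] at hf hf'
        refine hinj f hf.1 f' hf'.1 fun t ht => ?_
        rcases eq_or_lt_of_le (Nat.lt_succ_iff.1 ht) with rfl | ht
        · exact hff
        · have := congrFun (hf.2.trans hf'.2.symm) t
          simpa [hτ, ht] using this
      rw [← Finset.sum_image (f := fun s => q n (Function.update g n s)) hi]
      refine Finset.sum_le_sum_of_subset_of_nonneg ?_ fun _ _ _ => hq _ _
      intro s hs
      obtain ⟨f, hf, rfl⟩ := Finset.mem_image.1 hs
      exact hA f (Finset.mem_filter.1 hf).1 n (by omega)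
    refine (Finset.sum_le_sum key).trans ?_
    rw [← Finset.sum_mul]
    refine mul_le_mul_of_nonneg_right ?_ hcn
    refine ih (fun t ht => hc t (by omega)) _ ?_ ?_
    · intro g hg t ht
      obtain ⟨f, hf, rfl⟩ := Finset.mem_image.1 hg
      simpa [hτ, ht] using hA f hf t (by omega)
    · intro g hg g' hg' h
      obtain ⟨f, hf, rfl⟩ := Finset.mem_image.1 hg
      obtain ⟨f', hf', rfl⟩ := Finset.mem_image.1 hg'
      funext t
      by_cases ht : t < n
      · exact h t ht
      · simp [hτ, ht]

theorem prod_range_eq_prod_pairs (f : ℕ → ℝ) (N : ℕ) :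
    ∏ r ∈ Finset.range N, f (r + 1) =
      (∏ t ∈ Finset.range (N / 2), f (t + 1) * f (N - t)) *
        ∏ t ∈ Finset.range (N % 2), f (N / 2 + t + 1) := by
  obtain ⟨R, e, hR, he⟩ : ∃ R e, R = N / 2 ∧ e = N % 2 := ⟨_, _, rfl, rfl⟩
  have hN : N = R + e + R := by omega
  rw [← hR, ← he, Finset.prod_mul_distrib]
  conv_lhs => rw [hN]
  rw [Finset.prod_range_add, Finset.prod_range_add]
  have : ∏ t ∈ Finset.range R, f (R + e + t + 1) = ∏ t ∈ Finset.range R, f (N - t) := by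
    rw [← Finset.prod_range_reflect]
    refine Finset.prod_congr rfl fun t ht => ?_
    have := Finset.mem_range.1 ht
    congr 1
    omega
  rw [this]
  ring

theorem sum_Icc_one_pow_le {x : ℝ} (hx0 : 0 ≤ x) (hx1 : x < 1) (K : ℕ) :
    ∑ k ∈ Finset.Icc 1 K, x ^ k ≤ (1 - x)⁻¹ := by
  have h := (summable_geometric_of_lt_one hx0 hx1).sum_le_tsum (Finset.Icc 1 K)
    (fun _ _ => by positivity)
  rwa [tsum_geometric_of_lt_one hx0 hx1] at h

/-- The version of `sum_prod_le_prod_of_step` in which the positions `1, …, N` are revealed in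
pairs `(1, N), (2, N - 1), …`. -/
theorem sum_prod_le_of_pairs {x : ℝ} (hx0 : 0 ≤ x) (hx1 : x < 1) (N K : ℕ)
    (q : ℕ → (ℕ → ℕ × ℕ) → ℝ) (c : ℕ → ℝ) (hq : ∀ t f, 0 ≤ q t f)
    (hdep : ∀ t f g, (∀ j ≤ t, f j = g j) → q t f = q t g)
    (hc : ∀ t < N / 2, ∀ f : ℕ → ℕ × ℕ,
      ∑ s ∈ Finset.Icc 1 K ×ˢ Finset.Icc 1 K, q t (Function.update f t s) ≤ c t)
    (Y : Finset (ℕ → ℕ)) (hcap : ∀ k ∈ Y, ∀ r, 1 ≤ r → r ≤ N → 1 ≤ k r ∧ k r ≤ K)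
    (hinj : ∀ k ∈ Y, ∀ l ∈ Y, (∀ r, 1 ≤ r → r ≤ N → k r = l r) → k = l)
    (hle : ∀ k ∈ Y, ∏ t ∈ Finset.range (N / 2), x ^ k (t + 1) * x ^ k (N - t) ≤
      ∏ t ∈ Finset.range (N / 2), q t (fun j => (k (j + 1), k (N - j)))) :
    ∑ k ∈ Y, ∏ r ∈ Finset.range N, x ^ k (r + 1) ≤
      (∏ t ∈ Finset.range (N / 2), c t) * (1 - x)⁻¹ := by
  classical
  set R := N / 2 with hR
  set s : (ℕ → ℕ) → ℕ → ℕ × ℕ :=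
    fun k t => if t < R then (k (t + 1), k (N - t)) else (k (t + 1), 0) with hs
  set q' : ℕ → (ℕ → ℕ × ℕ) → ℝ := fun t f => if t < R then q t f else x ^ (f t).1 with hq'
  set A : ℕ → Finset (ℕ × ℕ) := fun t =>
    if t < R then Finset.Icc 1 K ×ˢ Finset.Icc 1 K else Finset.Icc 1 K ×ˢ {0} with hA
  have hsinj : ∀ k ∈ Y, ∀ l ∈ Y, (∀ t < R + N % 2, s k t = s l t) → k = l := by
    intro k hk l hl h
    refine hinj k hk l hl fun r hr1 hr2 => ?_
    by_cases h1 : r ≤ R + N % 2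
    · have := h (r - 1) (by omega)
      simp only [hs] at this
      rw [Nat.sub_add_cancel hr1] at this
      split_ifs at this <;> exact congrArg Prod.fst this
    · have := h (N - r) (by omega)
      simp only [hs] at this
      rw [if_pos (by omega), if_pos (by omega), show N - (N - r) = r by omega] at this
      exact congrArg Prod.snd this
  have main := sum_prod_le_prod_of_step A q' (fun t => if t < R then c t else (1 - x)⁻¹)
    (fun t f => by simp only [hq']; split_ifs; exacts [hq t f, by positivity])
    (fun t f g h => by
      simp only [hq']
      split_ifs
      · exact hdep t f g h
      · rw [h t le_rfl])
    (R + N % 2)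
    (fun t _ f => by
      simp only [hq', hA]
      split_ifs with h
      · exact hc t h f
      · rw [Finset.sum_product]
        simpa using sum_Icc_one_pow_le hx0 hx1 K)
    (Y.image s)
    (by
      intro f hf t ht
      obtain ⟨k, hk, rfl⟩ := Finset.mem_image.1 hf
      simp only [hA, hs]
      split_ifs with h
      · have h1 := hcap k hk (t + 1) (by omega) (by omega)
        have h2 := hcap k hk (N - t) (by omega) (by omega)
        simp [h1, h2]
      · have h1 := hcap k hk (t + 1) (by omega) (by omega)
        simp [h1])
    (by
      intro f hf g hg h
      obtain ⟨k, hk, rfl⟩ := Finset.mem_image.1 hf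
      obtain ⟨l, hl, rfl⟩ := Finset.mem_image.1 hg
      rw [hsinj k hk l hl h])
  rw [Finset.sum_image (fun k hk l hl h => hsinj k hk l hl fun t _ => congrFun h t)] at main
  have hpos : (0 : ℝ) ≤ 1 - x := by linarith
  have hcnn : 0 ≤ ∏ t ∈ Finset.range R, c t :=
    Finset.prod_nonneg fun t ht =>
      (Finset.sum_nonneg fun _ _ => hq _ _).trans (hc t (Finset.mem_range.1 ht) default)
  refine le_trans (Finset.sum_le_sum fun k hk => ?_) (main.trans ?_)
  · rw [prod_range_eq_prod_pairs (fun r => x ^ k r), Finset.prod_range_add]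
    refine mul_le_mul ((hle k hk).trans_eq ?_) (le_of_eq ?_)
      (Finset.prod_nonneg fun _ _ => by positivity)
      (Finset.prod_nonneg fun t _ => by simp only [hq']; split_ifs; exacts [hq _ _, by positivity])
    · refine Finset.prod_congr rfl fun t ht => ?_
      have ht := Finset.mem_range.1 ht
      simp only [hq']
      rw [if_pos ht]
      refine hdep _ _ _ fun j hj => ?_
      simp only [hs]
      rw [if_pos (by omega)]
    · refine Finset.prod_congr rfl fun t ht => ?_
      simp [hq', hs, hR]
  · rw [Finset.prod_range_add]
    refine mul_le_mul (le_of_eq ?_) ?_ (Finset.prod_nonneg fun t _ => ?_) hcnn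
    · exact Finset.prod_congr rfl fun t ht => if_pos (Finset.mem_range.1 ht)
    · have h1 : (1 : ℝ) ≤ (1 - x)⁻¹ := (one_le_inv₀ (by linarith)).2 (by linarith)
      rcases Nat.mod_two_eq_zero_or_one N with h | h <;> simp [h, h1]
    · split_ifs
      · omega
      · exact inv_nonneg.2 hpos

/-- Pairs of values in `[1, K]` with sum at least `K`. -/
def heavyPairs (K : ℕ) : Finset (ℕ × ℕ) :=
  (Finset.Icc 1 K ×ˢ Finset.Icc 1 K).filter fun s => K ≤ s.1 + s.2

/-- A potential `H` on pairs certifying, for the weight `x ^ (u + v)`, the bound `A` for steps with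
one restricted entry, `A ^ 2` for steps with two of them, `B` for unrestricted steps, and `ρ` for
steps constrained by an earlier one. -/
structure IsPotential (x : ℝ) (K : ℕ) (H : ℕ × ℕ → ℝ) (A B ρ : ℝ) : Prop where
  pos : ∀ s, 0 < H s
  start : ∀ h, h = 1 ∨ h = H →
    ∑ s ∈ (heavyPairs K).filter (fun s => 2 ≤ s.1), x ^ (s.1 + s.2) * h s ≤ A
  start_both : ∀ h, h = 1 ∨ h = H →
    ∑ s ∈ (heavyPairs K).filter (fun s => 2 ≤ s.1 ∧ 2 ≤ s.2), x ^ (s.1 + s.2) * h s ≤ A ^ 2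
  free : ∀ h, h = 1 ∨ h = H → ∑ s ∈ heavyPairs K, x ^ (s.1 + s.2) * h s ≤ B
  step : ∀ h, h = 1 ∨ h = H → ∀ p ∈ heavyPairs K,
    ∑ s ∈ (heavyPairs K).filter (fun s => (p.1 = 1 → s.1 ≤ 2) ∧ (s.2 = 1 → p.2 ≤ 2)),
      x ^ (s.1 + s.2) * h s ≤ ρ * H p

/-- The cost of the `t`-th pair of a ladder of length `N` with step `a` and start `b`. -/
noncomputable def ladderCost (A B ρ : ℝ) (N a b t : ℕ) : ℝ :=
  if a ≤ t then ρ else if t < b then (if N - t ≤ b then A ^ 2 else A) else B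

/-- A ladder of length `N` with step `a` and start `b`: values in `[1, K]` on `[1, N]` such that
symmetric entries have sum at least `K`, the first `b` entries are at least `2`, and an entry `1`
forces the entry `a` positions later to be at most `2`. -/
structure IsLadder (K N a b : ℕ) (k : ℕ → ℕ) : Prop where
  cap : ∀ r, 1 ≤ r → r ≤ N → 1 ≤ k r ∧ k r ≤ K
  pair : ∀ r, 1 ≤ r → r ≤ N → K ≤ k r + k (N + 1 - r)
  start : ∀ r, 1 ≤ r → r ≤ N → r ≤ b → 2 ≤ k r
  step : ∀ r, 1 ≤ r → r + a ≤ N → k r = 1 → k (r + a) ≤ 2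

theorem prod_div_shift_eq_one (H : ℕ → ℝ) (hH : ∀ t, 0 < H t) (a R : ℕ) :
    ∏ t ∈ Finset.range R,
      ((if t + a < R then H t else 1) / (if a ≤ t then H (t - a) else 1)) = 1 := by
  rw [Finset.prod_div_distrib]
  by_cases h : a ≤ R
  · obtain ⟨d, rfl⟩ := Nat.exists_eq_add_of_le h
    have h1 : ∏ t ∈ Finset.range (a + d), (if a ≤ t then H (t - a) else 1) =
        ∏ t ∈ Finset.range d, H t := by
      rw [Finset.prod_range_add, Finset.prod_eq_one, one_mul]
      · exact Finset.prod_congr rfl fun t _ => by simp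
      · intro t ht
        rw [if_neg (by simpa using ht)]
    have h2 : ∏ t ∈ Finset.range (a + d), (if t + a < a + d then H t else 1) =
        ∏ t ∈ Finset.range d, H t := by
      rw [add_comm a d, Finset.prod_range_add, Finset.prod_eq_one (s := Finset.range a), mul_one]
      · refine Finset.prod_congr rfl fun t ht => ?_
        rw [if_pos (by have := Finset.mem_range.1 ht; omega)]
      · intro t _
        rw [if_neg (by omega)]
    rw [h1, h2, div_self (Finset.prod_pos fun t _ => hH t).ne']
  · rw [Finset.prod_eq_one, Finset.prod_eq_one, div_one]
    · intro t ht
      rw [if_neg (by have := Finset.mem_range.1 ht; omega)]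
    · intro t ht
      rw [if_neg (by have := Finset.mem_range.1 ht; omega)]

theorem sum_ladder_le {x : ℝ} (hx0 : 0 < x) (hx1 : x < 1) {K : ℕ} {H : ℕ × ℕ → ℝ} {A B ρ : ℝ}
    (hρ : 0 ≤ ρ) (hP : IsPotential x K H A B ρ) {N a b : ℕ} (ha : 1 ≤ a) (hba : b ≤ a)
    (Y : Finset (ℕ → ℕ)) (hY : ∀ k ∈ Y, IsLadder K N a b k)
    (hinj : ∀ k ∈ Y, ∀ l ∈ Y, (∀ r, 1 ≤ r → r ≤ N → k r = l r) → k = l) :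
    ∑ k ∈ Y, ∏ r ∈ Finset.range N, x ^ k (r + 1) ≤
      (∏ t ∈ Finset.range (N / 2), ladderCost A B ρ N a b t) * (1 - x)⁻¹ := by
  classical
  set h : ℕ → ℕ × ℕ → ℝ := fun t => if t + a < N / 2 then H else 1 with hh
  have hh' : ∀ t, h t = 1 ∨ h t = H := fun t => by
    simp only [hh]; split_ifs <;> simp
  have hpos : ∀ t s, 0 < h t s := fun t s => by
    rcases hh' t with e | e <;> rw [e]
    · exact one_pos
    · exact hP.pos s
  set V : ℕ → (ℕ → ℕ × ℕ) → Prop := fun t f =>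
    f t ∈ heavyPairs K ∧ (t < b → 2 ≤ (f t).1) ∧ (N - t ≤ b → 2 ≤ (f t).2) ∧
      (a ≤ t → f (t - a) ∈ heavyPairs K ∧ ((f (t - a)).1 = 1 → (f t).1 ≤ 2) ∧
        ((f t).2 = 1 → (f (t - a)).2 ≤ 2)) with hV
  refine sum_prod_le_of_pairs hx0.le hx1 N K
    (fun t f => if V t f then x ^ ((f t).1 + (f t).2) * h t (f t) /
      (if a ≤ t then H (f (t - a)) else 1) else 0) _ ?_ ?_ ?_ Y (fun k hk => (hY k hk).cap) hinj ?_
  · intro t f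
    have := (hpos t (f t)).le
    have := (hP.pos (f (t - a))).le
    split_ifs <;> positivity
  · intro t f g hfg
    simp only [hV, hfg t le_rfl, hfg (t - a) (Nat.sub_le _ _)]
  · intro t ht f
    have hnn : ∀ s : ℕ × ℕ, 0 ≤ x ^ (s.1 + s.2) * h t s := fun s =>
      mul_nonneg (by positivity) (hpos t s).le
    have hsub : ∀ (P : ℕ × ℕ → Prop) [DecidablePred P],
        (∀ s, V t (Function.update f t s) → P s) →
        ∑ s ∈ Finset.Icc 1 K ×ˢ Finset.Icc 1 K,
          (if V t (Function.update f t s) then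
            x ^ (((Function.update f t s) t).1 + ((Function.update f t s) t).2) *
              h t ((Function.update f t s) t) / 1 else 0) ≤
          ∑ s ∈ (heavyPairs K).filter P, x ^ (s.1 + s.2) * h t s := by
      intro P _ hVP
      rw [← Finset.sum_filter]
      simp only [Function.update_self, div_one]
      refine Finset.sum_le_sum_of_subset_of_nonneg ?_ fun s _ _ => hnn s
      intro s hs
      have hs := (Finset.mem_filter.1 hs).2
      refine Finset.mem_filter.2 ⟨?_, hVP s hs⟩
      have := hs.1
      rwa [Function.update_self] at this
    unfold ladderCost
    split_ifs with h1 h2 h3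
    · by_cases hp : f (t - a) ∈ heavyPairs K
      · have hne : t - a ≠ t := by omega
        have := hP.step (h t) (hh' t) _ hp
        rw [← div_le_iff₀ (hP.pos _), Finset.sum_div] at this
        refine le_trans ?_ this
        rw [← Finset.sum_filter]
        simp only [Function.update_self, Function.update_of_ne hne]
        refine Finset.sum_le_sum_of_subset_of_nonneg ?_ fun s _ _ =>
          div_nonneg (hnn s) (hP.pos _).le
        intro s hs
        have hs := (Finset.mem_filter.1 hs).2
        simp only [hV, Function.update_self, Function.update_of_ne hne] at hs
        exact Finset.mem_filter.2 ⟨hs.1, (hs.2.2.2 h1).2⟩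
      · rw [Finset.sum_eq_zero]
        · exact hρ
        · intro s _
          have hne : t - a ≠ t := by omega
          rw [if_neg]
          simp only [hV, Function.update_of_ne hne]
          exact fun hs => hp (hs.2.2.2 h1).1
    · refine (hsub (fun s => 2 ≤ s.1 ∧ 2 ≤ s.2) ?_).trans (hP.start_both _ (hh' t))
      intro s hs
      simp only [hV, Function.update_self] at hs
      exact ⟨hs.2.1 h2, hs.2.2.1 h3⟩
    · refine (hsub (fun s => 2 ≤ s.1) ?_).trans (hP.start _ (hh' t))
      intro s hs
      simp only [hV, Function.update_self] at hs
      exact hs.2.1 h2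
    · refine (hsub (fun s => True) (fun _ _ => trivial)).trans ?_
      simpa using hP.free _ (hh' t)
  · intro k hk
    have hk := hY k hk
    refine le_of_eq ?_
    have hmem : ∀ j, j < N / 2 → (k (j + 1), k (N - j)) ∈ heavyPairs K := by
      intro j hj
      have h1 := hk.cap (j + 1) (by omega) (by omega)
      have h2 := hk.cap (N - j) (by omega) (by omega)
      have h3 := hk.pair (j + 1) (by omega) (by omega)
      rw [show N + 1 - (j + 1) = N - j by omega] at h3
      simp [heavyPairs, h1, h2, h3]
    have hVk : ∀ t < N / 2, V t (fun j => (k (j + 1), k (N - j))) := by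
      intro t ht
      refine ⟨hmem t ht, fun h => hk.start _ (by omega) (by omega) (by omega),
        fun h => hk.start _ (by omega) (by omega) (by omega),
        fun h => ⟨hmem _ (by omega), fun h1 => ?_, fun h1 => ?_⟩⟩
      · have := hk.step (t - a + 1) (by omega) (by omega) h1
        rwa [show t - a + 1 + a = t + 1 by omega] at this
      · have := hk.step (N - t) (by omega) (by omega) h1
        rwa [show N - t + a = N - (t - a) by omega] at this
    have h1 := prod_div_shift_eq_one (fun t => H (k (t + 1), k (N - t)))
      (fun t => hP.pos _) a (N / 2)
    refine (mul_one _).symm.trans ((congrArg _ h1.symm).trans ?_)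
    rw [← Finset.prod_mul_distrib]
    refine Finset.prod_congr rfl fun t ht => ?_
    have ht := Finset.mem_range.1 ht
    rw [if_pos (hVk t ht), ← pow_add, mul_div_assoc]
    simp only [hh]
    congr 2
    split_ifs <;> rfl

theorem pow_eq_of_sq_eq {x : ℝ} (hx : x ^ 2 = 1 - x) :
    x ^ 3 = 2 * x - 1 ∧ x ^ 4 = 2 - 3 * x ∧ x ^ 5 = 5 * x - 3 ∧ x ^ 6 = 5 - 8 * x ∧
      x ^ 7 = 13 * x - 8 ∧ x ^ 8 = 13 - 21 * x ∧ x ^ 9 = 34 * x - 21 ∧ x ^ 10 = 34 - 55 * x := by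
  have h3 : x ^ 3 = 2 * x - 1 := by linear_combination (x - 1) * hx
  have h4 : x ^ 4 = 2 - 3 * x := by linear_combination x * h3 + 2 * hx
  have h5 : x ^ 5 = 5 * x - 3 := by linear_combination x * h4 - 3 * hx
  have h6 : x ^ 6 = 5 - 8 * x := by linear_combination x * h5 + 5 * hx
  have h7 : x ^ 7 = 13 * x - 8 := by linear_combination x * h6 - 8 * hx
  have h8 : x ^ 8 = 13 - 21 * x := by linear_combination x * h7 + 13 * hx
  have h9 : x ^ 9 = 34 * x - 21 := by linear_combination x * h8 - 21 * hx
  have h10 : x ^ 10 = 34 - 55 * x := by linear_combination x * h9 + 34 * hx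
  exact ⟨h3, h4, h5, h6, h7, h8, h9, h10⟩

theorem bounds_of_sq_eq {x : ℝ} (hx0 : 0 < x) (hx : x ^ 2 = 1 - x) :
    0.61803 < x ∧ x < 0.61804 := by
  constructor <;> nlinarith

/-- A potential depending only on whether `u = 1` and whether `v ≤ 2`. -/
noncomputable def blockPotential (h₁ h₂ h₃ h₄ : ℝ) (s : ℕ × ℕ) : ℝ :=
  if s.1 = 1 then (if s.2 ≤ 2 then h₁ else h₂) else (if s.2 ≤ 2 then h₃ else h₄)

theorem of_mem_heavyPairs {K a b : ℕ} (h : (a, b) ∈ heavyPairs K) :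
    1 ≤ a ∧ a ≤ K ∧ 1 ≤ b ∧ b ≤ K ∧ K ≤ a + b := by
  simp only [heavyPairs, Finset.mem_filter, Finset.mem_product, Finset.mem_Icc] at h
  omega

theorem isPotential_three {x : ℝ} (hx0 : 0 < x) (hx : x ^ 2 = 1 - x) :
    IsPotential x 3 (blockPotential 0.865 0.626 1.161 0.774) 0.84 1.15 0.99 := by
  obtain ⟨h3, h4, h5, h6, -⟩ := pow_eq_of_sq_eq hx
  obtain ⟨l, u⟩ := bounds_of_sq_eq hx0 hx
  refine ⟨fun s => by unfold blockPotential; split_ifs <;> norm_num, ?_, ?_, ?_, ?_⟩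
  all_goals rintro h (rfl | rfl)
  all_goals try
    rintro ⟨a, b⟩ hp
    obtain ⟨ha, ha', hb, hb', hab⟩ := of_mem_heavyPairs hp
    clear hp
    interval_cases a <;> interval_cases b
  any_goals omega
  all_goals
    simp [heavyPairs, blockPotential, Finset.sum_filter, Finset.sum_product,
      Finset.sum_Icc_succ_top, h3, h4, h5, h6]
    linarith

set_option maxHeartbeats 1000000 in
theorem isPotential_four {x : ℝ} (hx0 : 0 < x) (hx : x ^ 2 = 1 - x) :
    IsPotential x 4 (blockPotential 1.07 0.535 1.07 0.831) 0.84 1.15 0.99 := by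
  obtain ⟨h3, h4, h5, h6, h7, h8, -⟩ := pow_eq_of_sq_eq hx
  obtain ⟨l, u⟩ := bounds_of_sq_eq hx0 hx
  refine ⟨fun s => by unfold blockPotential; split_ifs <;> norm_num, ?_, ?_, ?_, ?_⟩
  all_goals rintro h (rfl | rfl)
  all_goals try
    rintro ⟨a, b⟩ hp
    obtain ⟨ha, ha', hb, hb', hab⟩ := of_mem_heavyPairs hp
    clear hp
    interval_cases a <;> interval_cases b
  any_goals omega
  all_goals
    simp [heavyPairs, blockPotential, Finset.sum_filter, Finset.sum_product,
      Finset.sum_Icc_succ_top, h4, h5, h6, h7, h8]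
    linarith

theorem sum_heavyPairs_five_le {x : ℝ} (hx0 : 0 < x) (hx : x ^ 2 = 1 - x) :
    ∑ s ∈ heavyPairs 5, x ^ (s.1 + s.2) ≤ 0.8755 := by
  obtain ⟨h3, h4, h5, h6, h7, h8, h9, h10⟩ := pow_eq_of_sq_eq hx
  obtain ⟨l, u⟩ := bounds_of_sq_eq hx0 hx
  simp [heavyPairs, Finset.sum_filter, Finset.sum_product,
      Finset.sum_Icc_succ_top, h5, h6, h7, h8, h9, h10]
  linarith

theorem isPotential_five {x : ℝ} (hx0 : 0 < x) (hx : x ^ 2 = 1 - x) :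
    IsPotential x 5 1 0.84 1.15 0.99 := by
  obtain ⟨h3, h4, h5, h6, h7, h8, h9, h10⟩ := pow_eq_of_sq_eq hx
  obtain ⟨l, u⟩ := bounds_of_sq_eq hx0 hx
  have hfive := sum_heavyPairs_five_le hx0 hx
  refine ⟨fun s => one_pos, ?_, ?_, ?_, ?_⟩
  all_goals rintro h hh
  all_goals obtain rfl : h = 1 := by simpa using hh
  · simp [heavyPairs, Finset.sum_filter, Finset.sum_product,
      Finset.sum_Icc_succ_top, h5, h6, h7, h8, h9, h10]
    linarith
  · simp [heavyPairs, Finset.sum_filter, Finset.sum_product,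
      Finset.sum_Icc_succ_top, h5, h6, h7, h8, h9, h10]
    linarith
  · simp only [Pi.one_apply, mul_one]
    linarith
  · intro p _
    simp only [Pi.one_apply, mul_one]
    refine (Finset.sum_le_sum_of_subset_of_nonneg (Finset.filter_subset _ _) fun _ _ _ => by
      positivity).trans ?_
    linarith

theorem sum_range_ite_lt (R b : ℕ) :
    ∑ t ∈ Finset.range R, (if t < b then 1 else 0) = min R b := by
  induction R with
  | zero => simp
  | succ R ih => rw [Finset.sum_range_succ, ih]; split_ifs <;> omega

theorem sum_range_ite_sub_le {N b : ℕ} (R : ℕ) (hR : R ≤ N) :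
    ∑ t ∈ Finset.range R, (if N - t ≤ b then 1 else 0) = R - (N - b) := by
  induction R with
  | zero => simp
  | succ R ih => rw [Finset.sum_range_succ, ih (by omega)]; split_ifs <;> omega

theorem prod_ladderCost_le (N : ℕ) {a b : ℕ} (hba : b ≤ a) :
    ∏ t ∈ Finset.range (N / 2), ladderCost 0.84 1.15 0.99 N a b t ≤
      0.99 ^ (N / 2) * (0.84 / 0.99) ^ (min N b - 1) *
        (1.15 / 0.99) ^ (min (N / 2) a - min (N / 2) b) := by
  have key : ∀ t ∈ Finset.range (N / 2), ladderCost 0.84 1.15 0.99 N a b t ≤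
      (0.99 : ℝ) * (0.84 / 0.99) ^ ((if t < b then 1 else 0) + (if N - t ≤ b then 1 else 0)) *
        (1.15 / 0.99) ^ ((if t < a then 1 else 0) - (if t < b then 1 else 0)) := by
    intro t ht
    have ht := Finset.mem_range.1 ht
    unfold ladderCost
    split_ifs <;> first | omega | norm_num
  refine (Finset.prod_le_prod (fun t _ => ?_) key).trans ?_
  · unfold ladderCost
    split_ifs <;> norm_num
  · rw [Finset.prod_mul_distrib, Finset.prod_mul_distrib, Finset.prod_const, Finset.card_range,
      Finset.prod_pow_eq_pow_sum, Finset.prod_pow_eq_pow_sum, Finset.sum_add_distrib,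
      sum_range_ite_lt, sum_range_ite_sub_le _ (by omega)]
    have h1 : ∑ t ∈ Finset.range (N / 2), ((if t < a then 1 else 0) - (if t < b then 1 else 0)) =
        min (N / 2) a - min (N / 2) b := by
      have h := sum_range_ite_lt (N / 2) a
      have h' := sum_range_ite_lt (N / 2) b
      rw [← h, ← h']
      refine Finset.sum_tsub_distrib _ fun t _ => ?_
      split_ifs <;> omega
    rw [h1]
    refine mul_le_mul_of_nonneg_right (mul_le_mul_of_nonneg_left ?_ (by positivity))
      (by positivity)
    exact pow_le_pow_of_le_one (by norm_num) (by norm_num) (by omega)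

theorem sum_heavyPairs_le {x : ℝ} (hx0 : 0 < x) (hx : x ^ 2 = 1 - x) {K : ℕ} (hK : 5 ≤ K) :
    ∑ s ∈ heavyPairs K, x ^ (s.1 + s.2) ≤ 0.99 ^ K := by
  obtain ⟨l, u⟩ := bounds_of_sq_eq hx0 hx
  rcases eq_or_lt_of_le hK with rfl | hK6
  · exact (sum_heavyPairs_five_le hx0 hx).trans (by norm_num)
  have h1x : (0 : ℝ) < 1 - x := by linarith
  have hrow : ∀ u ∈ Finset.Icc 1 K,
      ∑ v ∈ Finset.Icc 1 K, (if K ≤ u + v then x ^ (u + v) else 0) ≤ x ^ (K - 2) := by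
    intro u _
    rw [← Finset.sum_filter]
    have h1 : ∑ v ∈ (Finset.Icc 1 K).filter (fun v => K ≤ u + v), x ^ (u + v) =
        x ^ K * ∑ j ∈ ((Finset.Icc 1 K).filter (fun v => K ≤ u + v)).image (fun v => u + v - K),
          x ^ j := by
      rw [Finset.sum_image, Finset.mul_sum]
      · refine Finset.sum_congr rfl fun v hv => ?_
        rw [← pow_add, Nat.add_sub_cancel' (Finset.mem_filter.1 hv).2]
      · intro v hv w hw h
        simp only [Finset.coe_filter, Set.mem_ofPred_eq] at hv hw
        dsimp only at h
        omega
    have h2 := (summable_geometric_of_lt_one hx0.le (by linarith : x < 1)).sum_le_tsum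
      (((Finset.Icc 1 K).filter (fun v => K ≤ u + v)).image (fun v => u + v - K))
      (fun _ _ => by positivity)
    rw [tsum_geometric_of_lt_one hx0.le (by linarith), ← hx] at h2
    rw [h1]
    refine (mul_le_mul_of_nonneg_left h2 (by positivity)).trans_eq ?_
    rw [← Nat.sub_add_cancel (show 2 ≤ K by omega), pow_add, mul_assoc,
      mul_inv_cancel₀ (by positivity), mul_one]
    simp
  have hsum : ∑ s ∈ heavyPairs K, x ^ (s.1 + s.2) ≤ K * x ^ (K - 2) := by
    rw [heavyPairs, Finset.sum_filter, Finset.sum_product]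
    refine (Finset.sum_le_sum hrow).trans ?_
    simp
  refine hsum.trans ?_
  clear hsum hrow hK
  induction K, hK6 using Nat.le_induction with
  | base =>
    have h4 := (pow_eq_of_sq_eq hx).2.1
    norm_num [h4]
    linarith
  | succ K hK ih =>
    have hK' : (6 : ℝ) ≤ K := by exact_mod_cast hK
    have e : x ^ (K + 1 - 2) = x ^ (K - 2) * x := by
      rw [← pow_succ]; congr 1; omega
    rw [e, pow_succ]
    have hp : 0 < x ^ (K - 2) := by positivity
    push_cast
    calc ((K : ℝ) + 1) * (x ^ (K - 2) * x) = x ^ (K - 2) * ((K + 1) * x) := by ring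
      _ ≤ x ^ (K - 2) * (K * 0.99) := by
        refine mul_le_mul_of_nonneg_left ?_ hp.le
        nlinarith
      _ = K * x ^ (K - 2) * 0.99 := by ring
      _ ≤ _ := mul_le_mul_of_nonneg_right ih (by norm_num)

theorem sum_heavy_le {x : ℝ} (hx0 : 0 < x) (hx : x ^ 2 = 1 - x) {K : ℕ} (hK : 5 ≤ K) {N : ℕ}
    (Y : Finset (ℕ → ℕ)) (hcap : ∀ k ∈ Y, ∀ r, 1 ≤ r → r ≤ N → 1 ≤ k r ∧ k r ≤ K)
    (hpair : ∀ k ∈ Y, ∀ r, 1 ≤ r → r ≤ N → K ≤ k r + k (N + 1 - r))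
    (hinj : ∀ k ∈ Y, ∀ l ∈ Y, (∀ r, 1 ≤ r → r ≤ N → k r = l r) → k = l) :
    ∑ k ∈ Y, ∏ r ∈ Finset.range N, x ^ k (r + 1) ≤ 0.99 ^ (K * (N / 2)) * (1 - x)⁻¹ := by
  obtain ⟨l, u⟩ := bounds_of_sq_eq hx0 hx
  have := sum_prod_le_of_pairs hx0.le (by linarith) N K
    (fun t f => if K ≤ (f t).1 + (f t).2 then x ^ ((f t).1 + (f t).2) else 0)
    (fun _ => 0.99 ^ K) (fun t f => by split_ifs <;> positivity)
    (fun t f g h => by simp only [h t le_rfl])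
    (fun t _ f => by
      have := sum_heavyPairs_le hx0 hx hK
      rw [heavyPairs, Finset.sum_filter] at this
      simpa using this)
    Y hcap hinj
    (fun k hk => le_of_eq <| Finset.prod_congr rfl fun t ht => by
      have ht := Finset.mem_range.1 ht
      have h := hpair k hk (t + 1) (by omega) (by omega)
      rw [show N + 1 - (t + 1) = N - t by omega] at h
      rw [if_pos h, pow_add])
  simpa [← pow_mul] using this

/-- The total weight of a family of sequences with prescribed upper bounds. -/
theorem sum_prod_le_prod_caps {y : ℝ} (hy : 0 ≤ y) (N : ℕ) (cap : ℕ → ℕ)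
    (Y : Finset (ℕ → ℕ)) (hcap : ∀ k ∈ Y, ∀ r, 1 ≤ r → r ≤ N → 1 ≤ k r ∧ k r ≤ cap r)
    (hinj : ∀ k ∈ Y, ∀ l ∈ Y, (∀ r, 1 ≤ r → r ≤ N → k r = l r) → k = l) :
    ∑ k ∈ Y, ∏ r ∈ Finset.range N, y ^ k (r + 1) ≤
      ∏ r ∈ Finset.range N, ∑ j ∈ Finset.Icc 1 (cap (r + 1)), y ^ j := by
  classical
  have hinj' : ∀ k ∈ Y, ∀ l ∈ Y, (∀ t < N, k (t + 1) = l (t + 1)) → k = l := by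
    intro k hk l hl h
    refine hinj k hk l hl fun r h1 h2 => ?_
    have := h (r - 1) (by omega)
    rwa [Nat.sub_add_cancel h1] at this
  have := sum_prod_le_prod_of_step (fun t => Finset.Icc 1 (cap (t + 1))) (fun t f => y ^ f t)
    (fun t => ∑ j ∈ Finset.Icc 1 (cap (t + 1)), y ^ j) (fun _ _ => by positivity)
    (fun t f g h => by simp only [h t le_rfl]) N (fun t _ f => by simp)
    (Y.image fun k t => k (t + 1))
    (by
      intro f hf t ht
      obtain ⟨k, hk, rfl⟩ := Finset.mem_image.1 hf
      simpa using hcap k hk (t + 1) (by omega) (by omega))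
    (by
      intro f hf g hg h
      obtain ⟨k, hk, rfl⟩ := Finset.mem_image.1 hf
      obtain ⟨l, hl, rfl⟩ := Finset.mem_image.1 hg
      rw [hinj' k hk l hl h])
  rwa [Finset.sum_image (fun k hk l hl h => hinj' k hk l hl fun t _ => congrFun h t)] at this

namespace NumericalSemigroup

variable (S : NumericalSemigroup)

theorem mem_of_frobenius_lt {n : ℕ} (h : S.frobenius < n) : n ∈ S.carrier := by
  by_contra hn
  exact absurd (le_csSup S.cofinite.bddAbove hn) (by simpa [frobenius] using h)

theorem frobenius_notMem (h : S.genus ≠ 0) : S.frobenius ∉ S.carrier := by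
  have hne : (S.carrierᶜ).Nonempty := by
    rw [Set.nonempty_iff_ne_empty]
    intro h0
    exact h (by rw [genus, h0, Set.ncard_empty])
  exact Nat.sSup_mem hne S.cofinite.bddAbove

theorem multiplicity_spec : S.multiplicity ∈ S.carrier ∧ S.multiplicity ≠ 0 :=
  Nat.sInf_mem (s := {n : ℕ | n ∈ S.carrier ∧ n ≠ 0})
    ⟨S.frobenius + 1, S.mem_of_frobenius_lt (Nat.lt_succ_self _), Nat.succ_ne_zero _⟩

theorem multiplicity_mem : S.multiplicity ∈ S.carrier := S.multiplicity_spec.1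

theorem multiplicity_pos : 0 < S.multiplicity := Nat.pos_of_ne_zero S.multiplicity_spec.2

theorem notMem_of_lt_multiplicity {n : ℕ} (h0 : 0 < n) (h : n < S.multiplicity) :
    n ∉ S.carrier := fun hn => by
  have : S.multiplicity ≤ n :=
    Nat.sInf_le (s := {n : ℕ | n ∈ S.carrier ∧ n ≠ 0}) ⟨hn, h0.ne'⟩
  omega

theorem mul_multiplicity_mem (k : ℕ) : k * S.multiplicity ∈ S.carrier := by
  induction k with
  | zero => simpa using S.zero_mem
  | succ k ih => rw [Nat.succ_mul]; exact S.add_mem ih S.multiplicity_mem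

theorem ext_carrier {S T : NumericalSemigroup} (h : S.carrier = T.carrier) : S = T := by
  cases S; cases T; cases h; rfl

/-- The Kunz coordinate: the least `k` such that `r + k * m` lies in the semigroup, where `m` is
the multiplicity. -/
noncomputable def kunz (r : ℕ) : ℕ := sInf {k | r + k * S.multiplicity ∈ S.carrier}

theorem add_kunz_mul_mem (r : ℕ) : r + S.kunz r * S.multiplicity ∈ S.carrier :=
  Nat.sInf_mem (s := {k | r + k * S.multiplicity ∈ S.carrier}) ⟨S.frobenius + 1, by
    refine S.mem_of_frobenius_lt ?_
    have := Nat.le_mul_of_pos_right (S.frobenius + 1) S.multiplicity_pos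
    omega⟩

theorem kunz_le_iff {r k : ℕ} : S.kunz r ≤ k ↔ r + k * S.multiplicity ∈ S.carrier := by
  refine ⟨fun h => ?_, fun h => Nat.sInf_le h⟩
  obtain ⟨d, rfl⟩ := Nat.exists_eq_add_of_le h
  rw [Nat.add_mul, ← Nat.add_assoc]
  exact S.add_mem (S.add_kunz_mul_mem r) (S.mul_multiplicity_mem d)

theorem kunz_pos {r : ℕ} (h0 : 0 < r) (h : r < S.multiplicity) : 1 ≤ S.kunz r := by
  by_contra hk
  have := S.kunz_le_iff.1 (show S.kunz r ≤ 0 by omega)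
  exact S.notMem_of_lt_multiplicity h0 h (by simpa using this)

theorem kunz_zero : S.kunz 0 = 0 := Nat.le_zero.1 (S.kunz_le_iff.2 (by simpa using S.zero_mem))

theorem kunz_add_le (a b : ℕ) : S.kunz (a + b) ≤ S.kunz a + S.kunz b := by
  rw [kunz_le_iff, Nat.add_mul, Nat.add_add_add_comm]
  exact S.add_mem (S.add_kunz_mul_mem a) (S.add_kunz_mul_mem b)

theorem kunz_le_of_add_eq {a b c : ℕ} (h : a + b = c + S.multiplicity) :
    S.kunz c ≤ S.kunz a + S.kunz b + 1 := by
  rw [kunz_le_iff]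
  have := S.add_mem (S.add_kunz_mul_mem a) (S.add_kunz_mul_mem b)
  rw [Nat.add_add_add_comm, h] at this
  convert this using 1
  ring

theorem kunz_le_of_frobenius_lt {r k : ℕ} (h : S.frobenius < r + k * S.multiplicity) :
    S.kunz r ≤ k := S.kunz_le_iff.2 (S.mem_of_frobenius_lt h)

theorem ext_kunz {S T : NumericalSemigroup} (hm : S.multiplicity = T.multiplicity)
    (h : ∀ r, 1 ≤ r → r < S.multiplicity → S.kunz r = T.kunz r) : S = T := by
  refine ext_carrier (Set.ext fun n => ?_)
  have hS : ∀ U : NumericalSemigroup, n ∈ U.carrier ↔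
      U.kunz (n % U.multiplicity) ≤ n / U.multiplicity := fun U => by
    rw [kunz_le_iff, Nat.mul_comm, Nat.mod_add_div]
  rw [hS, hS, ← hm]
  rcases Nat.eq_zero_or_pos (n % S.multiplicity) with h0 | h0
  · simp [h0, kunz_zero]
  · rw [h _ h0 (Nat.mod_lt _ S.multiplicity_pos)]

theorem genus_eq_sum : S.genus = ∑ r ∈ Finset.range (S.multiplicity - 1), S.kunz (r + 1) := by
  have hm := S.multiplicity_pos
  have key : S.carrierᶜ = ↑(((Finset.range S.multiplicity).sigma
      (fun r => Finset.range (S.kunz r))).image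
      (fun p => p.1 + p.2 * S.multiplicity)) := by
    ext n
    simp only [Set.mem_compl_iff, Finset.coe_image, Set.mem_image, Finset.mem_coe,
      Finset.mem_sigma, Finset.mem_range]
    constructor
    · intro hn
      refine ⟨⟨n % S.multiplicity, n / S.multiplicity⟩, ⟨Nat.mod_lt _ hm, ?_⟩, ?_⟩
      · by_contra hk
        have := S.kunz_le_iff.1 (not_lt.1 hk)
        rw [Nat.mul_comm, Nat.mod_add_div] at this
        exact hn this
      · dsimp only
        rw [Nat.mul_comm, Nat.mod_add_div]
    · rintro ⟨⟨r, k⟩, ⟨_, hk⟩, rfl⟩ hn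
      exact absurd (S.kunz_le_iff.2 hn) (not_le.2 hk)
  rw [genus, key, Set.ncard_coe_finset, Finset.card_image_of_injOn, Finset.card_sigma]
  · simp only [Finset.card_range]
    obtain ⟨m, hm'⟩ := Nat.exists_eq_succ_of_ne_zero hm.ne'
    rw [hm', Nat.succ_sub_one, Finset.sum_range_succ', kunz_zero, add_zero]
  · rintro ⟨r, k⟩ hp ⟨s, l⟩ hq h
    simp only [Finset.coe_sigma, Set.mem_sigma_iff, Finset.coe_range, Set.mem_Iio] at hp hq
    dsimp only at h
    have h1 : r = s := by
      have := congrArg (· % S.multiplicity) h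
      simpa [Nat.add_mul_mod_self_right, Nat.mod_eq_of_lt hp.1, Nat.mod_eq_of_lt hq.1] using this
    subst h1
    have h2 : k = l := Nat.eq_of_mul_eq_mul_right hm (Nat.add_left_cancel h)
    subst h2
    rfl

theorem pow_genus (x : ℝ) :
    x ^ S.genus = ∏ r ∈ Finset.range (S.multiplicity - 1), x ^ S.kunz (r + 1) := by
  rw [genus_eq_sum, Finset.prod_pow_eq_pow_sum]

theorem lt_two_mul_genus {n : ℕ} (hn : n ∉ S.carrier) : n < 2 * S.genus := by
  have hG := S.cofinite
  have h : Finset.range (n + 1) ⊆ hG.toFinset ∪ hG.toFinset.image (fun a => n - a) := by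
    intro a ha
    have ha := Finset.mem_range.1 ha
    simp only [Finset.mem_union, Set.Finite.mem_toFinset, Finset.mem_image, Set.mem_compl_iff]
    by_contra hc
    push Not at hc
    refine hn ?_
    have h1 : n - a ∈ S.carrier := by
      by_contra h2
      exact hc.2 (n - a) h2 (by omega)
    have := S.add_mem hc.1 h1
    rwa [Nat.add_sub_cancel' (by omega)] at this
  have h1 := (Finset.card_le_card h).trans (Finset.card_union_le _ _)
  have h2 := Finset.card_image_le (s := hG.toFinset) (f := fun a => n - a)
  rw [← Set.ncard_eq_toFinset_card _ hG, ← genus] at h1 h2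
  rw [Finset.card_range] at h1
  omega

theorem genus_le_frobenius : S.genus ≤ S.frobenius := by
  have h : S.carrierᶜ ⊆ ↑(Finset.Icc 1 S.frobenius) := fun n hn => by
    rw [Finset.coe_Icc, Set.mem_Icc]
    refine ⟨Nat.one_le_iff_ne_zero.2 fun h0 => hn (h0 ▸ S.zero_mem), ?_⟩
    by_contra hc
    exact hn (S.mem_of_frobenius_lt (not_le.1 hc))
  have := Set.ncard_le_ncard h (Finset.finite_toSet _)
  rwa [Set.ncard_coe_finset, Nat.card_Icc, Nat.add_sub_cancel] at this

theorem multiplicity_le_genus_add_one : S.multiplicity ≤ S.genus + 1 := by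
  rw [genus_eq_sum]
  have : ∑ r ∈ Finset.range (S.multiplicity - 1), 1 ≤
      ∑ r ∈ Finset.range (S.multiplicity - 1), S.kunz (r + 1) :=
    Finset.sum_le_sum fun r hr => S.kunz_pos (by omega) (by
      have := Finset.mem_range.1 hr
      omega)
  simp at this
  omega

theorem finite_genus_eq (g : ℕ) : {S : NumericalSemigroup | S.genus = g}.Finite := by
  refine Set.Finite.of_injOn (f := fun S => S.carrierᶜ)
    (t := (Set.powerset (Set.Iio (2 * g)))) ?_ ?_ (Set.finite_Iio _).powerset
  · rintro S rfl n hn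
    exact S.lt_two_mul_genus hn
  · intro S _ T _ h
    exact ext_carrier (compl_injective h)

theorem frobenius_mod_pos (h : S.genus ≠ 0) : 0 < S.frobenius % S.multiplicity := by
  refine Nat.pos_of_ne_zero fun h0 => S.frobenius_notMem h ?_
  rw [← Nat.mod_add_div S.frobenius S.multiplicity, h0, zero_add, Nat.mul_comm]
  exact S.mul_multiplicity_mem _

theorem kunz_le_div_add_one (r : ℕ) :
    S.kunz r ≤ S.frobenius / S.multiplicity + 1 := by
  refine S.kunz_le_of_frobenius_lt ?_
  have := Nat.lt_div_mul_add (a := S.frobenius) S.multiplicity_pos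
  rw [Nat.add_mul]
  omega

theorem kunz_le_div {r : ℕ} (h : S.frobenius % S.multiplicity < r) :
    S.kunz r ≤ S.frobenius / S.multiplicity := by
  refine S.kunz_le_of_frobenius_lt ?_
  have := Nat.mod_add_div S.frobenius S.multiplicity
  rw [Nat.mul_comm] at this
  omega

theorem kunz_frobenius_mod (h : S.genus ≠ 0) :
    S.kunz (S.frobenius % S.multiplicity) = S.frobenius / S.multiplicity + 1 := by
  refine le_antisymm (S.kunz_le_div_add_one _) ?_
  by_contra hc
  have := S.kunz_le_iff.1 (show S.kunz (S.frobenius % S.multiplicity) ≤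
    S.frobenius / S.multiplicity by omega)
  rw [Nat.mul_comm, Nat.mod_add_div] at this
  exact S.frobenius_notMem h this

/-- The first residue whose Kunz coordinate is one, or the multiplicity if there is none. -/
noncomputable def firstOne : ℕ :=
  sInf {r | 1 ≤ r ∧ (S.kunz r = 1 ∨ S.multiplicity ≤ r)}

theorem firstOne_spec : 1 ≤ S.firstOne ∧ (S.kunz S.firstOne = 1 ∨ S.multiplicity ≤ S.firstOne) :=
  Nat.sInf_mem (s := {r | 1 ≤ r ∧ (S.kunz r = 1 ∨ S.multiplicity ≤ r)})
    ⟨S.multiplicity, S.multiplicity_pos, Or.inr le_rfl⟩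

theorem firstOne_le : S.firstOne ≤ S.multiplicity :=
  Nat.sInf_le (s := {r | 1 ≤ r ∧ (S.kunz r = 1 ∨ S.multiplicity ≤ r)})
    ⟨S.multiplicity_pos, Or.inr le_rfl⟩

theorem two_le_kunz_of_lt_firstOne {r : ℕ} (h0 : 1 ≤ r) (h : r < S.firstOne) :
    2 ≤ S.kunz r := by
  have h1 := S.kunz_pos h0 (h.trans_le S.firstOne_le)
  by_contra hc
  exact absurd (Nat.sInf_le (s := {r | 1 ≤ r ∧ (S.kunz r = 1 ∨ S.multiplicity ≤ r)})
    ⟨h0, Or.inl (by omega)⟩) (not_le.2 h)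

theorem kunz_add_firstOne_le {r : ℕ} (h : r + S.firstOne < S.multiplicity) (hr : S.kunz r = 1) :
    S.kunz (r + S.firstOne) ≤ 2 := by
  have := S.kunz_add_le r S.firstOne
  rcases S.firstOne_spec.2 with h1 | h1
  · omega
  · omega

end NumericalSemigroup

/-- The restriction of `k` to `[1, N]`, extended by zero. -/
def truncate (N : ℕ) (k : ℕ → ℕ) (r : ℕ) : ℕ := if 1 ≤ r ∧ r ≤ N then k r else 0

theorem truncate_apply {N : ℕ} (k : ℕ → ℕ) {r : ℕ} (h1 : 1 ≤ r) (h2 : r ≤ N) :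
    truncate N k r = k r := if_pos ⟨h1, h2⟩

theorem truncate_congr {N : ℕ} {k l : ℕ → ℕ}
    (h : ∀ r, 1 ≤ r → r ≤ N → truncate N k r = truncate N l r) : truncate N k = truncate N l := by
  funext r
  by_cases hr : 1 ≤ r ∧ r ≤ N
  · exact h r hr.1 hr.2
  · simp [truncate, hr]

theorem IsLadder.truncate {K N a b : ℕ} {k : ℕ → ℕ} (h : IsLadder K N a b k) :
    IsLadder K N a b (truncate N k) where
  cap r h1 h2 := by rw [truncate_apply k h1 h2]; exact h.cap r h1 h2
  pair r h1 h2 := by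
    rw [truncate_apply k h1 h2, truncate_apply k (by omega) (by omega)]; exact h.pair r h1 h2
  start r h1 h2 h3 := by rw [truncate_apply k h1 h2]; exact h.start r h1 h2 h3
  step r h1 h2 h3 := by
    rw [truncate_apply k h1 (by omega)] at h3
    rw [truncate_apply k (by omega) h2]; exact h.step r h1 h2 h3

namespace NumericalSemigroup

/-- The Kunz coordinates strictly below the residue `i`. -/
noncomputable def lowerKunz (i : ℕ) (S : NumericalSemigroup) : ℕ → ℕ := truncate (i - 1) S.kunz

/-- The Kunz coordinates strictly above the residue `i`, shifted by `i`. -/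
noncomputable def upperKunz (i N : ℕ) (S : NumericalSemigroup) : ℕ → ℕ :=
  truncate N fun r => S.kunz (i + r)

open Classical in
theorem sum_pow_genus_le {x : ℝ} (hx0 : 0 < x) {m i Q : ℕ} (hi0 : 0 < i) (him : i < m)
    (A : Finset NumericalSemigroup) (hm : ∀ S ∈ A, S.multiplicity = m)
    (hQ : ∀ S ∈ A, S.kunz i = Q + 1) :
    ∑ S ∈ A, x ^ S.genus ≤ x ^ (Q + 1) *
      ((∑ k ∈ A.image (lowerKunz i), ∏ r ∈ Finset.range (i - 1), x ^ k (r + 1)) *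
      ∑ k ∈ A.image (upperKunz i (m - 1 - i)), ∏ r ∈ Finset.range (m - 1 - i), x ^ k (r + 1)) := by
  rw [Finset.sum_mul_sum, ← Finset.sum_product', Finset.mul_sum]
  have hterm : ∀ S ∈ A, x ^ S.genus = x ^ (Q + 1) *
      ((∏ r ∈ Finset.range (i - 1), x ^ lowerKunz i S (r + 1)) *
        ∏ r ∈ Finset.range (m - 1 - i), x ^ upperKunz i (m - 1 - i) S (r + 1)) := by
    intro S hS
    rw [S.pow_genus, hm S hS, show m - 1 = (i - 1) + ((m - 1 - i) + 1) by omega,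
      Finset.prod_range_add, Finset.prod_range_succ',
      show i - 1 + 0 + 1 = i by omega, hQ S hS]
    have h1 : ∏ r ∈ Finset.range (i - 1), x ^ S.kunz (r + 1) =
        ∏ r ∈ Finset.range (i - 1), x ^ lowerKunz i S (r + 1) :=
      Finset.prod_congr rfl fun r hr => by
        rw [lowerKunz, truncate_apply _ (by omega) (by have := Finset.mem_range.1 hr; omega)]
    have h2 : ∏ r ∈ Finset.range (m - 1 - i), x ^ S.kunz (i - 1 + (r + 1) + 1) =
        ∏ r ∈ Finset.range (m - 1 - i), x ^ upperKunz i (m - 1 - i) S (r + 1) :=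
      Finset.prod_congr rfl fun r hr => by
        rw [upperKunz, truncate_apply _ (by omega) (by have := Finset.mem_range.1 hr; omega),
          show i - 1 + (r + 1) + 1 = i + (r + 1) by omega]
    rw [h1]
    simp only [show i - 1 + (m - 1 - i + 1) - i = m - 1 - i by omega, h2]
    ring
  rw [Finset.sum_congr rfl hterm]
  have hinj : Set.InjOn (fun S => (lowerKunz i S, upperKunz i (m - 1 - i) S)) (A : Set _) := by
    intro S hS T hT h
    simp only [Prod.mk.injEq] at h
    refine ext_kunz ((hm S hS).trans (hm T hT).symm) fun r h1 h2 => ?_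
    rw [hm S hS] at h2
    rcases lt_trichotomy r i with hr | rfl | hr
    · have := congrFun h.1 r
      rwa [lowerKunz, lowerKunz, truncate_apply _ h1 (by omega),
        truncate_apply _ h1 (by omega)] at this
    · rw [hQ S hS, hQ T hT]
    · have := congrFun h.2 (r - i)
      rwa [upperKunz, upperKunz, truncate_apply _ (by omega) (by omega),
        truncate_apply _ (by omega) (by omega), Nat.add_sub_cancel' hr.le] at this
  rw [← Finset.sum_image (s := A) (g := fun S => (lowerKunz i S, upperKunz i (m - 1 - i) S))
    (f := fun p : (ℕ → ℕ) × (ℕ → ℕ) => x ^ (Q + 1) *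
      ((∏ r ∈ Finset.range (i - 1), x ^ p.1 (r + 1)) *
        ∏ r ∈ Finset.range (m - 1 - i), x ^ p.2 (r + 1))) hinj]
  refine Finset.sum_le_sum_of_subset_of_nonneg ?_ fun _ _ _ => by positivity
  intro p hp
  obtain ⟨S, hS, rfl⟩ := Finset.mem_image.1 hp
  exact Finset.mem_product.2 ⟨Finset.mem_image_of_mem _ hS, Finset.mem_image_of_mem _ hS⟩

variable (S : NumericalSemigroup)

theorem isLadder_lower (hg : S.genus ≠ 0) :
    IsLadder (S.frobenius / S.multiplicity + 1) (S.frobenius % S.multiplicity - 1)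
      S.firstOne (S.firstOne - 1) S.kunz := by
  have hi := Nat.mod_lt S.frobenius S.multiplicity_pos
  refine ⟨fun r h1 h2 => ⟨S.kunz_pos h1 (by omega), S.kunz_le_div_add_one r⟩,
    fun r h1 h2 => ?_, fun r h1 h2 h3 => S.two_le_kunz_of_lt_firstOne h1 (by omega),
    fun r h1 h2 h3 => S.kunz_add_firstOne_le (by omega) h3⟩
  have := S.kunz_add_le r (S.frobenius % S.multiplicity - 1 + 1 - r)
  rwa [show r + (S.frobenius % S.multiplicity - 1 + 1 - r) = S.frobenius % S.multiplicity by omega,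
    S.kunz_frobenius_mod hg] at this

theorem isLadder_upper (hg : S.genus ≠ 0) :
    IsLadder (S.frobenius / S.multiplicity) (S.multiplicity - 1 - S.frobenius % S.multiplicity)
      S.firstOne (S.firstOne - 1 - S.frobenius % S.multiplicity)
      (fun r => S.kunz (S.frobenius % S.multiplicity + r)) := by
  have hi := Nat.mod_lt S.frobenius S.multiplicity_pos
  refine ⟨fun r h1 h2 => ⟨S.kunz_pos (by omega) (by omega), S.kunz_le_div (by omega)⟩,
    fun r h1 h2 => ?_, fun r h1 h2 h3 => S.two_le_kunz_of_lt_firstOne (by omega) (by omega),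
    fun r h1 h2 h3 => ?_⟩
  · have := S.kunz_le_of_add_eq (a := S.frobenius % S.multiplicity + r)
      (b := S.frobenius % S.multiplicity +
        (S.multiplicity - 1 - S.frobenius % S.multiplicity + 1 - r))
      (c := S.frobenius % S.multiplicity) (by omega)
    rw [S.kunz_frobenius_mod hg] at this
    omega
  · rw [← add_assoc]
    exact S.kunz_add_firstOne_le (by omega) h3

end NumericalSemigroup

namespace NumericalSemigroup

/-- The four parameters recorded of a semigroup: its multiplicity `m`, the quotient and the
remainder of its Frobenius number modulo `m`, and the first residue with Kunz coordinate one. -/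
noncomputable def shape (S : NumericalSemigroup) : ℕ × ℕ × ℕ × ℕ :=
  (S.multiplicity, S.frobenius / S.multiplicity, S.frobenius % S.multiplicity, S.firstOne)

section Regions

variable {x : ℝ} {m Q i a : ℕ} (A : Finset NumericalSemigroup)

open Classical in
theorem isLadder_of_mem_image_lowerKunz
    (hA : ∀ S ∈ A, S.genus ≠ 0 ∧ S.shape = (m, Q, i, a)) :
    ∀ k ∈ A.image (lowerKunz i), IsLadder (Q + 1) (i - 1) a (a - 1) k := by
  intro k hk
  obtain ⟨S, hS, rfl⟩ := Finset.mem_image.1 hk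
  obtain ⟨hg, hs⟩ := hA S hS
  simp only [shape, Prod.mk.injEq] at hs
  obtain ⟨rfl, rfl, rfl, rfl⟩ := hs
  exact (S.isLadder_lower hg).truncate

open Classical in
theorem isLadder_of_mem_image_upperKunz
    (hA : ∀ S ∈ A, S.genus ≠ 0 ∧ S.shape = (m, Q, i, a)) :
    ∀ k ∈ A.image (upperKunz i (m - 1 - i)), IsLadder Q (m - 1 - i) a (a - 1 - i) k := by
  intro k hk
  obtain ⟨S, hS, rfl⟩ := Finset.mem_image.1 hk
  obtain ⟨hg, hs⟩ := hA S hS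
  simp only [shape, Prod.mk.injEq] at hs
  obtain ⟨rfl, rfl, rfl, rfl⟩ := hs
  exact (S.isLadder_upper hg).truncate

open Classical in
theorem eq_of_mem_image_lowerKunz :
    ∀ k ∈ A.image (lowerKunz i), ∀ l ∈ A.image (lowerKunz i),
      (∀ r, 1 ≤ r → r ≤ i - 1 → k r = l r) → k = l := by
  intro k hk l hl h
  obtain ⟨S, -, rfl⟩ := Finset.mem_image.1 hk
  obtain ⟨T, -, rfl⟩ := Finset.mem_image.1 hl
  exact truncate_congr h

open Classical in
theorem eq_of_mem_image_upperKunz {N : ℕ} :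
    ∀ k ∈ A.image (upperKunz i N), ∀ l ∈ A.image (upperKunz i N),
      (∀ r, 1 ≤ r → r ≤ N → k r = l r) → k = l := by
  intro k hk l hl h
  obtain ⟨S, -, rfl⟩ := Finset.mem_image.1 hk
  obtain ⟨T, -, rfl⟩ := Finset.mem_image.1 hl
  exact truncate_congr h

theorem sum_pow_genus_le_of_shape
    (hA : ∀ S ∈ A, S.genus ≠ 0 ∧ S.shape = (m, Q, i, a))
    (hx0 : 0 < x) {U V : ℝ} (hU : 0 ≤ U)
    (hV : 0 ≤ V)
    (hlow : ∀ Y : Finset (ℕ → ℕ), (∀ k ∈ Y, IsLadder (Q + 1) (i - 1) a (a - 1) k) →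
      (∀ k ∈ Y, ∀ l ∈ Y, (∀ r, 1 ≤ r → r ≤ i - 1 → k r = l r) → k = l) →
      ∑ k ∈ Y, ∏ r ∈ Finset.range (i - 1), x ^ k (r + 1) ≤ U)
    (hupp : ∀ Y : Finset (ℕ → ℕ), (∀ k ∈ Y, IsLadder Q (m - 1 - i) a (a - 1 - i) k) →
      (∀ k ∈ Y, ∀ l ∈ Y, (∀ r, 1 ≤ r → r ≤ m - 1 - i → k r = l r) → k = l) →
      ∑ k ∈ Y, ∏ r ∈ Finset.range (m - 1 - i), x ^ k (r + 1) ≤ V) :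
    ∑ S ∈ A, x ^ S.genus ≤ x ^ (Q + 1) * (U * V) := by
  classical
  rcases A.eq_empty_or_nonempty with rfl | ⟨S, hS⟩
  · simp only [Finset.sum_empty]; positivity
  have hs := hA S hS
  simp only [shape, Prod.mk.injEq] at hs
  have hi0 : 0 < i := hs.2.2.2.1 ▸ S.frobenius_mod_pos hs.1
  have him : i < m := hs.2.2.2.1 ▸ hs.2.1 ▸ Nat.mod_lt _ S.multiplicity_pos
  refine (sum_pow_genus_le (Q := Q) hx0 hi0 him A (fun T hT => ?_) (fun T hT => ?_)).trans ?_
  · exact congrArg Prod.fst (hA T hT).2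
  · have ht := hA T hT
    simp only [shape, Prod.mk.injEq] at ht
    rw [← ht.2.2.2.1, ← ht.2.2.1]
    exact T.kunz_frobenius_mod ht.1
  · have h1 := hlow _ (isLadder_of_mem_image_lowerKunz A hA) (eq_of_mem_image_lowerKunz A)
    have h2 := hupp _ (isLadder_of_mem_image_upperKunz A hA) (eq_of_mem_image_upperKunz A)
    gcongr

end Regions

theorem alpha_pow_mul_beta_pow_le {p q n : ℕ} (hp : n ≤ p + 2) (hq : q ≤ n + 2) :
    (0.84 / 0.99 : ℝ) ^ p * (1.15 / 0.99) ^ q ≤ 2 := by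
  have h1 : (0.84 / 0.99 : ℝ) ^ (p + 2) ≤ (0.84 / 0.99) ^ n :=
    pow_le_pow_of_le_one (by norm_num) (by norm_num) hp
  have h2 : (1.15 / 0.99 : ℝ) ^ q ≤ (1.15 / 0.99) ^ (n + 2) :=
    pow_le_pow_right₀ (by norm_num) hq
  have h3 : ((0.84 / 0.99 : ℝ) * (1.15 / 0.99)) ^ n ≤ 1 :=
    pow_le_one₀ (by norm_num) (by norm_num)
  have h4 : (0 : ℝ) < (0.84 / 0.99) ^ p := by positivity
  have h5 : (0 : ℝ) < (1.15 / 0.99) ^ q := by positivity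
  have : (0.84 / 0.99 : ℝ) ^ (p + 2) * (1.15 / 0.99) ^ q ≤
      (0.84 / 0.99) ^ n * (1.15 / 0.99) ^ (n + 2) := by gcongr
  rw [pow_add _ n 2, ← mul_assoc, ← mul_pow] at this
  rw [pow_add] at this
  have h6 : (0 : ℝ) < (0.84 / 0.99) ^ p * (1.15 / 0.99) ^ q := by positivity
  norm_num at this h3 h6 ⊢
  nlinarith

variable {x : ℝ} {m Q i a : ℕ} (A : Finset NumericalSemigroup)

theorem sum_pow_genus_le_of_moderate (hx0 : 0 < x) (hx : x ^ 2 = 1 - x)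
    (hA : ∀ S ∈ A, S.genus ≠ 0 ∧ S.shape = (m, Q, i, a)) (hQ : Q = 3 ∨ Q = 4) :
    ∑ S ∈ A, x ^ S.genus ≤ 2 * (1 - x)⁻¹ ^ 2 * 0.99 ^ ((i - 1) / 2 + (m - 1 - i) / 2) := by
  obtain ⟨l, u⟩ := bounds_of_sq_eq hx0 hx
  rcases A.eq_empty_or_nonempty with rfl | ⟨S, hS⟩
  · simp only [Finset.sum_empty]; positivity
  have hs := (hA S hS).2
  simp only [shape, Prod.mk.injEq] at hs
  have ha : 1 ≤ a := hs.2.2.2 ▸ S.firstOne_spec.1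
  have hP : ∀ K, K = 3 ∨ K = 4 ∨ K = 5 → ∃ H, IsPotential x K H 0.84 1.15 0.99 := by
    rintro K (rfl | rfl | rfl)
    exacts [⟨_, isPotential_three hx0 hx⟩, ⟨_, isPotential_four hx0 hx⟩,
      ⟨_, isPotential_five hx0 hx⟩]
  obtain ⟨H₁, hH₁⟩ := hP (Q + 1) (by omega)
  obtain ⟨H₂, hH₂⟩ := hP Q (by omega)
  have h1x : (0 : ℝ) < (1 - x)⁻¹ := inv_pos.2 (by linarith)
  refine (sum_pow_genus_le_of_shape A hA hx0
    (mul_nonneg ?_ h1x.le) (mul_nonneg ?_ h1x.le)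
    (fun Y hY hinj => (sum_ladder_le hx0 (by linarith) (by norm_num) hH₁ ha (by omega) Y hY
      hinj).trans (mul_le_mul_of_nonneg_right (prod_ladderCost_le (i - 1) (by omega)) h1x.le))
    (fun Y hY hinj => (sum_ladder_le hx0 (by linarith) (by norm_num) hH₂ ha (by omega) Y hY
      hinj).trans (mul_le_mul_of_nonneg_right (prod_ladderCost_le (m - 1 - i) (by omega))
        h1x.le))).trans ?_
  · positivity
  · positivity
  set p := min (i - 1) (a - 1) - 1
  set q := min ((i - 1) / 2) a - min ((i - 1) / 2) (a - 1) with hq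
  set p' := min (m - 1 - i) (a - 1 - i) - 1
  set q' := min ((m - 1 - i) / 2) a - min ((m - 1 - i) / 2) (a - 1 - i) with hq'
  have h3 : (0.84 / 0.99 : ℝ) ^ p * (1.15 / 0.99) ^ (q + q') ≤ 2 :=
    alpha_pow_mul_beta_pow_le (n := min i a) (by omega) (by omega)
  have h4 : (0.84 / 0.99 : ℝ) ^ p' ≤ 1 := pow_le_one₀ (by norm_num) (by norm_num)
  have h5 : x ^ (Q + 1) ≤ 1 := pow_le_one₀ hx0.le (by linarith)
  calc _ = x ^ (Q + 1) * ((1 - x)⁻¹ ^ 2 * 0.99 ^ ((i - 1) / 2 + (m - 1 - i) / 2)) *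
        (((0.84 / 0.99 : ℝ) ^ p * (1.15 / 0.99) ^ (q + q')) * (0.84 / 0.99) ^ p') := by
        rw [pow_add, pow_add (1.15 / 0.99 : ℝ)]; ring
    _ ≤ 1 * ((1 - x)⁻¹ ^ 2 * 0.99 ^ ((i - 1) / 2 + (m - 1 - i) / 2)) * (2 * 1) := by gcongr
    _ = _ := by ring

theorem sum_pow_genus_le_of_two (hx0 : 0 < x) (hx : x ^ 2 = 1 - x)
    (hA : ∀ S ∈ A, S.genus ≠ 0 ∧ S.shape = (m, 2, i, a)) :
    ∑ S ∈ A, x ^ S.genus ≤ 2 * (1 - x)⁻¹ ^ 2 * 0.99 ^ ((i - 1) / 2) := by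
  obtain ⟨l, u⟩ := bounds_of_sq_eq hx0 hx
  rcases A.eq_empty_or_nonempty with rfl | ⟨S, hS⟩
  · simp only [Finset.sum_empty]; positivity
  have hs := (hA S hS).2
  simp only [shape, Prod.mk.injEq] at hs
  have ha : 1 ≤ a := hs.2.2.2 ▸ S.firstOne_spec.1
  have h1x : (0 : ℝ) < (1 - x)⁻¹ := inv_pos.2 (by linarith)
  have h1x' : (1 : ℝ) ≤ (1 - x)⁻¹ := (one_le_inv₀ (by linarith)).2 (by linarith)
  refine (sum_pow_genus_le_of_shape A hA hx0 (V := 1)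
    (mul_nonneg ?_ h1x.le) zero_le_one
    (fun Y hY hinj => (sum_ladder_le hx0 (by linarith) (by norm_num) (isPotential_three hx0 hx) ha
      (by omega) Y hY hinj).trans
        (mul_le_mul_of_nonneg_right (prod_ladderCost_le (i - 1) (by omega)) h1x.le))
    (fun Y hY hinj => (sum_prod_le_prod_caps hx0.le _ (fun _ => 2) Y
      (fun k hk => (hY k hk).cap) hinj).trans (le_of_eq ?_))).trans ?_
  · positivity
  · refine Finset.prod_eq_one fun r _ => ?_
    simp [Finset.sum_Icc_succ_top, hx]
  set p := min (i - 1) (a - 1) - 1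
  set q := min ((i - 1) / 2) a - min ((i - 1) / 2) (a - 1) with hq
  have h3 : (0.84 / 0.99 : ℝ) ^ p * (1.15 / 0.99) ^ q ≤ 2 :=
    alpha_pow_mul_beta_pow_le (n := min i a) (by omega) (by omega)
  have h5 : x ^ (2 + 1) ≤ 1 := pow_le_one₀ hx0.le (by linarith)
  calc _ = x ^ (2 + 1) * ((1 - x)⁻¹ * 1 * 0.99 ^ ((i - 1) / 2)) *
        ((0.84 / 0.99 : ℝ) ^ p * (1.15 / 0.99) ^ q) := by ring
    _ ≤ 1 * ((1 - x)⁻¹ * (1 - x)⁻¹ * 0.99 ^ ((i - 1) / 2)) * 2 := by gcongr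
    _ = _ := by ring

theorem sum_pow_genus_le_of_heavy (hx0 : 0 < x) (hx : x ^ 2 = 1 - x)
    (hA : ∀ S ∈ A, S.genus ≠ 0 ∧ S.shape = (m, Q, i, a)) (hQ : 5 ≤ Q) :
    ∑ S ∈ A, x ^ S.genus ≤ 2 * (1 - x)⁻¹ ^ 2 *
      0.99 ^ (Q * ((i - 1) / 2 + (m - 1 - i) / 2) + Q + 1) := by
  obtain ⟨l, u⟩ := bounds_of_sq_eq hx0 hx
  have h1x : (0 : ℝ) < (1 - x)⁻¹ := inv_pos.2 (by linarith)
  refine (sum_pow_genus_le_of_shape A hA hx0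
    (mul_nonneg (by positivity) h1x.le) (mul_nonneg (by positivity) h1x.le)
    (fun Y hY hinj => sum_heavy_le hx0 hx (by omega) Y (fun k hk => (hY k hk).cap)
      (fun k hk => (hY k hk).pair) hinj)
    (fun Y hY hinj => sum_heavy_le hx0 hx hQ Y (fun k hk => (hY k hk).cap)
      (fun k hk => (hY k hk).pair) hinj)).trans ?_
  have h1 : (0.99 : ℝ) ^ ((Q + 1) * ((i - 1) / 2)) ≤ 0.99 ^ (Q * ((i - 1) / 2)) :=
    pow_le_pow_of_le_one (by norm_num) (by norm_num) (by gcongr; omega)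
  have h2 : x ^ (Q + 1) ≤ 0.99 ^ (Q + 1) := pow_le_pow_left₀ hx0.le (by linarith) _
  calc _ ≤ (0.99 : ℝ) ^ (Q + 1) * (0.99 ^ (Q * ((i - 1) / 2)) * (1 - x)⁻¹ *
        (0.99 ^ (Q * ((m - 1 - i) / 2)) * (1 - x)⁻¹)) := by gcongr
    _ = 1 * ((1 - x)⁻¹ ^ 2 *
      0.99 ^ (Q * ((i - 1) / 2 + (m - 1 - i) / 2) + Q + 1)) := by
        rw [mul_add, add_assoc, pow_add _ (_ + _), pow_add _ (Q * _)]; ring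
    _ ≤ 2 * ((1 - x)⁻¹ ^ 2 *
      0.99 ^ (Q * ((i - 1) / 2 + (m - 1 - i) / 2) + Q + 1)) := by gcongr; norm_num
    _ = _ := by ring

end NumericalSemigroup

open Filter Topology

namespace NumericalSemigroup

/-- A property of numerical semigroups is negligible at `x` if the number of semigroups of genus
`g` having it is `o(x⁻ᵍ)`. -/
def Negligible (x : ℝ) (P : NumericalSemigroup → Prop) : Prop :=
  Tendsto (fun g : ℕ => ({S : NumericalSemigroup | S.genus = g ∧ P S}.ncard : ℝ) * x ^ g)
    atTop (𝓝 0)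

theorem Negligible.or {x : ℝ} (hx : 0 ≤ x) {P Q : NumericalSemigroup → Prop}
    (hP : Negligible x P) (hQ : Negligible x Q) : Negligible x (fun S => P S ∨ Q S) := by
  have h := Tendsto.add hP hQ
  rw [add_zero] at h
  refine squeeze_zero (fun g => by positivity) (fun g => ?_) h
  rw [← add_mul]
  refine mul_le_mul_of_nonneg_right ?_ (by positivity)
  have : {S : NumericalSemigroup | S.genus = g ∧ (P S ∨ Q S)} =
      {S : NumericalSemigroup | S.genus = g ∧ P S} ∪
        {S : NumericalSemigroup | S.genus = g ∧ Q S} := by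
    ext S
    simp only [Set.mem_ofPred_eq, Set.mem_union, and_or_left]
  rw [this]
  exact_mod_cast Set.ncard_union_le _ _

theorem Negligible.mono {x : ℝ} (hx : 0 ≤ x) {P Q : NumericalSemigroup → Prop}
    (hQ : Negligible x Q) (h : ∀ S : NumericalSemigroup, S.genus ≠ 0 → P S → Q S) :
    Negligible x P := by
  refine squeeze_zero' (Eventually.of_forall fun g => by positivity) ?_ hQ
  filter_upwards [eventually_ne_atTop 0] with g hg
  refine mul_le_mul_of_nonneg_right ?_ (by positivity)
  have hsub : {S : NumericalSemigroup | S.genus = g ∧ P S} ⊆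
      {S : NumericalSemigroup | S.genus = g ∧ Q S} :=
    fun S hS => ⟨hS.1, h S (by rw [hS.1]; exact hg) hS.2⟩
  exact_mod_cast Set.ncard_le_ncard hsub ((finite_genus_eq g).subset fun S hS => hS.1)

theorem negligible_of_sum_le {x : ℝ} (hx : 0 ≤ x) {P : NumericalSemigroup → Prop} {C σ : ℝ}
    {k : ℕ} (hσ0 : 0 ≤ σ) (hσ : σ < 1)
    (h : ∀ g : ℕ, g ≠ 0 → ∀ A : Finset NumericalSemigroup,
      (∀ S ∈ A, S.genus = g ∧ P S) → ∑ S ∈ A, x ^ S.genus ≤ (2 * g + 2 : ℝ) ^ k * (C * σ ^ g)) :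
    Negligible x P := by
  have hlim := (tendsto_pow_const_mul_const_pow_of_abs_lt_one k
    (by rwa [abs_of_nonneg hσ0] : |σ| < 1)).const_mul (4 ^ k * |C|)
  rw [mul_zero] at hlim
  refine squeeze_zero' (Eventually.of_forall fun g => by positivity) ?_ hlim
  filter_upwards [eventually_ne_atTop 0] with g hg
  have hfin : {S : NumericalSemigroup | S.genus = g ∧ P S}.Finite :=
    (finite_genus_eq g).subset fun S hS => hS.1
  have h1 := h g hg hfin.toFinset fun S hS => hfin.mem_toFinset.1 hS
  rw [Finset.sum_congr rfl (g := fun _ => x ^ g) fun S hS => by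
    rw [(hfin.mem_toFinset.1 hS).1], Finset.sum_const, nsmul_eq_mul,
    ← Set.ncard_eq_toFinset_card _ hfin] at h1
  have hg1 : (1 : ℝ) ≤ g := by exact_mod_cast Nat.one_le_iff_ne_zero.2 hg
  refine h1.trans ?_
  calc (2 * g + 2 : ℝ) ^ k * (C * σ ^ g) ≤ (4 * g : ℝ) ^ k * (|C| * σ ^ g) := by
        have h2 := le_abs_self C
        have h3 : (2 * g + 2 : ℝ) ≤ 4 * g := by linarith
        have h4 : C * σ ^ g ≤ |C| * σ ^ g := mul_le_mul_of_nonneg_right h2 (by positivity)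
        exact (mul_le_mul_of_nonneg_left h4 (by positivity)).trans
          (mul_le_mul_of_nonneg_right (pow_le_pow_left₀ (by positivity) h3 k) (by positivity))
    _ = _ := by rw [mul_pow]; ring

/-- A bound on the parts of a partition by a statistic with values in a box. -/
theorem sum_le_card_mul_of_fiber {β : Type*} [DecidableEq β] (A : Finset NumericalSemigroup)
    (f : NumericalSemigroup → β) (t : Finset β) (hf : ∀ S ∈ A, f S ∈ t) (w : NumericalSemigroup → ℝ)
    {B : ℝ} (hB : ∀ b ∈ t, ∑ S ∈ A with f S = b, w S ≤ B) : ∑ S ∈ A, w S ≤ t.card * B := by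
  rw [← Finset.sum_fiberwise_of_maps_to hf, ← nsmul_eq_mul]
  exact Finset.sum_le_card_nsmul _ _ _ hB

theorem shape_mem (S : NumericalSemigroup) :
    S.shape ∈ Finset.range (2 * S.genus + 2) ×ˢ Finset.range (2 * S.genus + 2) ×ˢ
      Finset.range (2 * S.genus + 2) ×ˢ Finset.range (2 * S.genus + 2) := by
  have h1 := S.multiplicity_le_genus_add_one
  have h2 := S.firstOne_le
  have h3 : S.frobenius ≤ 2 * S.genus := by
    rcases eq_or_ne S.genus 0 with h | h
    · have : S.carrierᶜ = ∅ := (Set.ncard_eq_zero S.cofinite).1 h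
      simp [frobenius, this]
    · exact (S.lt_two_mul_genus (S.frobenius_notMem h)).le
  have h4 := Nat.div_le_self S.frobenius S.multiplicity
  have h5 := Nat.mod_lt S.frobenius S.multiplicity_pos
  simp only [shape, Finset.mem_product, Finset.mem_range]
  omega

theorem sum_pow_genus_le_of_shape_of_le {x : ℝ} (hx0 : 0 < x) (hx : x ^ 2 = 1 - x) {ε : ℝ}
    (hε0 : 0 < ε) (hε1 : ε ≤ 1) {g : ℕ} (hg : g ≠ 0) (A : Finset NumericalSemigroup)
    {s : ℕ × ℕ × ℕ × ℕ}
    (hA : ∀ S ∈ A, S.genus = g ∧ (2 + ε) * S.multiplicity ≤ S.frobenius ∧ S.shape = s) :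
    ∑ S ∈ A, x ^ S.genus ≤
      2 * (1 - x)⁻¹ ^ 2 * (0.99 : ℝ) ^ (-2 : ℝ) * ((0.99 : ℝ) ^ (ε / 10)) ^ g := by
  obtain ⟨l, u⟩ := bounds_of_sq_eq hx0 hx
  obtain ⟨m, Q, i, a⟩ := s
  have hC : 0 ≤ 2 * (1 - x)⁻¹ ^ 2 := by positivity
  rcases A.eq_empty_or_nonempty with rfl | ⟨S, hS⟩
  · simp only [Finset.sum_empty]; positivity
  have hA' : ∀ S ∈ A, S.genus ≠ 0 ∧ S.shape = (m, Q, i, a) :=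
    fun S hS => ⟨by rw [(hA S hS).1]; exact hg, (hA S hS).2.2⟩
  have key : ∀ E : ℕ, ∑ S ∈ A, x ^ S.genus ≤ 2 * (1 - x)⁻¹ ^ 2 * 0.99 ^ E →
      ε / 10 * g - 2 ≤ E → ∑ S ∈ A, x ^ S.genus ≤
      2 * (1 - x)⁻¹ ^ 2 * (0.99 : ℝ) ^ (-2 : ℝ) * ((0.99 : ℝ) ^ (ε / 10)) ^ g := by
    intro E h1 h2
    refine h1.trans ?_
    rw [mul_assoc _ ((0.99 : ℝ) ^ (-2 : ℝ)), ← Real.rpow_mul_natCast (by norm_num),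
      ← Real.rpow_add (by norm_num), ← Real.rpow_natCast 0.99 E]
    refine mul_le_mul_of_nonneg_left ?_ hC
    exact Real.rpow_le_rpow_of_exponent_ge (by norm_num) (by norm_num) (by linarith)
  obtain ⟨h1, h2, h3⟩ := hA S hS
  have hg0 : S.genus ≠ 0 := h1 ▸ hg
  have hF := Nat.mod_add_div S.frobenius S.multiplicity
  have hgF := S.genus_le_frobenius
  have hi0 := S.frobenius_mod_pos hg0
  have him := Nat.mod_lt S.frobenius S.multiplicity_pos
  simp only [shape, Prod.mk.injEq] at h3
  obtain ⟨rfl, rfl, rfl, rfl⟩ := h3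
  rw [h1] at hgF
  set m := S.multiplicity
  set Q := S.frobenius / m
  set i := S.frobenius % m
  have hF' : (S.frobenius : ℝ) = i + m * Q := by exact_mod_cast hF.symm
  have hgF' : (g : ℝ) ≤ i + m * Q := by rw [← hF']; exact_mod_cast hgF
  have him' : (i : ℝ) < m := by exact_mod_cast him
  have hm0 : (0 : ℝ) < m := by exact_mod_cast S.multiplicity_pos
  rw [hF'] at h2
  have hQ2 : 2 ≤ Q := by
    by_contra hc
    have : (Q : ℝ) ≤ 1 := by exact_mod_cast (by omega : Q ≤ 1)
    nlinarith
  have hgε : ε / 10 * g ≤ ε / 10 * (i + m * Q) := by gcongr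
  have hR : (m : ℝ) ≤ 2 * ((i - 1) / 2 + (m - 1 - i) / 2 : ℕ) + 4 := by
    exact_mod_cast (by omega : m ≤ 2 * ((i - 1) / 2 + (m - 1 - i) / 2) + 4)
  rcases (by omega : Q = 2 ∨ (Q = 3 ∨ Q = 4) ∨ 5 ≤ Q) with hQ | hQ | hQ
  · refine key _ (sum_pow_genus_le_of_two A hx0 hx (m := m) (i := i) (a := S.firstOne)
      (by rw [← hQ]; exact hA')) ?_
    have hi : (i : ℝ) ≤ 2 * ((i - 1) / 2 : ℕ) + 2 := by
      exact_mod_cast (by omega : i ≤ 2 * ((i - 1) / 2) + 2)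
    rw [hQ] at h2 hgε
    push_cast at h2 hgε
    nlinarith
  · refine key _ (sum_pow_genus_le_of_moderate A hx0 hx hA' hQ) ?_
    have hQ4 : (Q : ℝ) ≤ 4 := by exact_mod_cast (by omega : Q ≤ 4)
    have : ε / 10 * (i + m * Q) ≤ 1 / 10 * (m + m * 4) := by gcongr
    linarith
  · refine key _ (sum_pow_genus_le_of_heavy A hx0 hx hA' hQ) ?_
    have hQ5 : (5 : ℝ) ≤ Q := by exact_mod_cast hQ
    have : ε / 10 * (i + m * Q) ≤ 1 / 10 * (m + m * Q) := by gcongr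
    push_cast at hR ⊢
    set R : ℝ := (((i - 1) / 2 : ℕ) : ℝ) + (((m - 1 - i) / 2 : ℕ) : ℝ) with hRdef
    have hR0 : 0 ≤ R := by positivity
    rcases le_total (m : ℝ) 10 with h | h
    · nlinarith [mul_nonneg (by linarith : (0:ℝ) ≤ Q) hR0]
    · nlinarith [mul_nonneg (by linarith : (0:ℝ) ≤ Q) (by linarith : 0 ≤ 2 * R + 4 - m)]

theorem negligible_of_large_frobenius {x : ℝ} (hx0 : 0 < x) (hx : x ^ 2 = 1 - x) {ε : ℝ}
    (hε0 : 0 < ε) (hε1 : ε ≤ 1) :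
    Negligible x (fun S => (2 + ε) * S.multiplicity ≤ S.frobenius) := by
  refine negligible_of_sum_le hx0.le (k := 4) (σ := (0.99 : ℝ) ^ (ε / 10))
    (C := 2 * (1 - x)⁻¹ ^ 2 * (0.99 : ℝ) ^ (-2 : ℝ)) (by positivity)
    (Real.rpow_lt_one (by norm_num) (by norm_num) (by positivity)) fun g hg A hA => ?_
  refine (sum_le_card_mul_of_fiber A shape _ (fun S hS => (hA S hS).1 ▸ S.shape_mem) _
    fun s _ => sum_pow_genus_le_of_shape_of_le hx0 hx hε0 hε1 hg _ (s := s)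
      fun S hS => ?_).trans_eq ?_
  · obtain ⟨hS, hs⟩ := Finset.mem_filter.1 hS
    exact ⟨(hA S hS).1, (hA S hS).2, hs⟩
  · simp only [Finset.card_product, Finset.card_range]
    push_cast
    ring

end NumericalSemigroup

namespace NumericalSemigroup

theorem sum_pow_genus_le_prod_caps {y : ℝ} (hy : 0 ≤ y) {m : ℕ} (cap : ℕ → ℕ)
    (A : Finset NumericalSemigroup) (hm : ∀ S ∈ A, S.multiplicity = m)
    (hcap : ∀ S ∈ A, ∀ r, 1 ≤ r → r < m → S.kunz r ≤ cap r) :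
    ∑ S ∈ A, y ^ S.genus ≤
      ∏ r ∈ Finset.range (m - 1), ∑ j ∈ Finset.Icc 1 (cap (r + 1)), y ^ j := by
  classical
  have hinj : Set.InjOn (fun S : NumericalSemigroup => truncate (m - 1) S.kunz) A := by
    intro S hS T hT h
    refine ext_kunz ((hm S hS).trans (hm T hT).symm) fun r h1 h2 => ?_
    rw [hm S hS] at h2
    have := congrFun h r
    dsimp only at this
    rwa [truncate_apply _ h1 (by omega), truncate_apply _ h1 (by omega)] at this
  refine le_trans (le_of_eq ?_) (sum_prod_le_prod_caps hy (m - 1) cap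
    (A.image fun S => truncate (m - 1) S.kunz) ?_ ?_)
  · rw [Finset.sum_image hinj]
    refine Finset.sum_congr rfl fun S hS => ?_
    rw [S.pow_genus, hm S hS]
    refine Finset.prod_congr rfl fun r hr => ?_
    have := Finset.mem_range.1 hr
    rw [truncate_apply _ (by omega) (by omega)]
  · intro k hk r h1 h2
    obtain ⟨S, hS, rfl⟩ := Finset.mem_image.1 hk
    rw [truncate_apply _ h1 h2]
    have := hm S hS
    exact ⟨S.kunz_pos h1 (by omega), hcap S hS r h1 (by omega)⟩
  · intro k hk l hl h
    obtain ⟨S, -, rfl⟩ := Finset.mem_image.1 hk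
    obtain ⟨T, -, rfl⟩ := Finset.mem_image.1 hl
    exact truncate_congr h

theorem multiplicity_mem_range (S : NumericalSemigroup) :
    S.multiplicity ∈ Finset.range (2 * S.genus + 2) := by
  have := S.multiplicity_le_genus_add_one
  exact Finset.mem_range.2 (by omega)

theorem negligible_of_small_frobenius {x : ℝ} (hx0 : 0 < x) (hx : x ^ 2 = 1 - x) {ε : ℝ}
    (hε0 : 0 < ε) (hε1 : ε ≤ 1) :
    Negligible x (fun S => (S.frobenius : ℝ) ≤ (2 - ε) * S.multiplicity) := by
  obtain ⟨l, u⟩ := bounds_of_sq_eq hx0 hx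
  refine negligible_of_sum_le hx0.le (k := 1) (σ := x ^ (ε / 2))
    (C := x ^ (-2 : ℝ)) (by positivity)
    (Real.rpow_lt_one hx0.le (by linarith) (by positivity)) fun g hg A hA => ?_
  refine (sum_le_card_mul_of_fiber A multiplicity _
    (fun S hS => (hA S hS).1 ▸ S.multiplicity_mem_range) _ (B := x ^ (-2 : ℝ) * (x ^ (ε / 2)) ^ g)
    fun m _ => ?_).trans_eq (by rw [Finset.card_range]; push_cast; ring)
  rcases (A.filter fun S => S.multiplicity = m).eq_empty_or_nonempty with h0 | ⟨T, hT⟩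
  · rw [h0, Finset.sum_empty]; positivity
  have hmε : (0 : ℝ) ≤ ε * m := by positivity
  have hd := Nat.floor_le hmε
  have hd' := Nat.lt_floor_add_one (ε * m)
  set d := ⌊ε * m⌋₊ with hd_def
  have hdm : d ≤ m := by
    have : (d : ℝ) ≤ m := hd.trans (by nlinarith [(Nat.cast_nonneg m : (0 : ℝ) ≤ m)])
    exact_mod_cast this
  have h1 := sum_pow_genus_le_prod_caps hx0.le (m := m) (fun r => if m - d < r then 1 else 2)
    (A.filter fun S => S.multiplicity = m) (fun S hS => (Finset.mem_filter.1 hS).2) (by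
      intro S hS r h1 h2
      obtain ⟨hS, hm⟩ := Finset.mem_filter.1 hS
      have hF := (hA S hS).2
      have hm0 : (0 : ℝ) ≤ m := by positivity
      rw [hm] at hF
      split_ifs with h
      · refine S.kunz_le_of_frobenius_lt ?_
        have h3 : (m : ℝ) + 1 ≤ r + d := by exact_mod_cast (by omega : m + 1 ≤ r + d)
        have : (S.frobenius : ℝ) < r + 1 * m := by nlinarith
        rw [hm]
        exact_mod_cast this
      · refine S.kunz_le_of_frobenius_lt ?_
        have h3 : (1 : ℝ) ≤ r := by exact_mod_cast h1
        have : (S.frobenius : ℝ) < r + 2 * m := by nlinarith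
        rw [hm]
        exact_mod_cast this)
  refine h1.trans ?_
  have hprod : ∏ r ∈ Finset.range (m - 1),
      ∑ j ∈ Finset.Icc 1 (if m - d < r + 1 then 1 else 2), x ^ j ≤ x ^ (d - 1) := by
    rcases Nat.eq_zero_or_pos d with h | h
    · rw [h]
      refine Finset.prod_le_one (fun _ _ => by positivity) fun r _ => ?_
      split_ifs
      · simp; linarith
      · simp [Finset.sum_Icc_succ_top, hx]
    · rw [show m - 1 = (m - d) + (d - 1) by omega, Finset.prod_range_add]
      rw [Finset.prod_eq_one, one_mul, Finset.prod_congr rfl (g := fun _ => x),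
        Finset.prod_const, Finset.card_range]
      · intro r _
        rw [if_pos (by omega)]
        simp
      · intro r hr
        have := Finset.mem_range.1 hr
        rw [if_neg (by omega)]
        simp [Finset.sum_Icc_succ_top, hx]
  refine hprod.trans ?_
  rw [← Real.rpow_mul_natCast hx0.le, ← Real.rpow_add hx0, ← Real.rpow_natCast]
  refine Real.rpow_le_rpow_of_exponent_ge hx0 (by linarith) ?_
  obtain ⟨hT, hm⟩ := Finset.mem_filter.1 hT
  have hF := (hA T hT).2
  have hgF : (T.genus : ℝ) ≤ T.frobenius := by exact_mod_cast T.genus_le_frobenius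
  rw [(hA T hT).1] at hgF
  rw [hm] at hF
  have h5 : (d : ℝ) ≤ (d - 1 : ℕ) + 1 := by exact_mod_cast (by omega : d ≤ d - 1 + 1)
  have : ε / 2 * g ≤ ε / 2 * (2 * m) := by
    refine mul_le_mul_of_nonneg_left ?_ (by positivity)
    nlinarith
  linarith

theorem sum_pow_genus_le_of_frobenius_lt {y : ℝ} (hy0 : 0 < y) (hy1 : y ≤ 1) {m : ℕ} {δ : ℝ}
    (hδ0 : 0 ≤ δ) (hδ1 : δ ≤ 1) (A : Finset NumericalSemigroup)
    (hm : ∀ S ∈ A, S.multiplicity = m)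
    (hF : ∀ S ∈ A, (S.frobenius : ℝ) < (2 + δ) * S.multiplicity) :
    ∑ S ∈ A, y ^ S.genus ≤ (2 : ℝ) ^ (δ * m) * (y + y ^ 2) ^ (m - 1) := by
  have hmδ : (0 : ℝ) ≤ δ * m := by positivity
  have hd := Nat.floor_le hmδ
  have hd' := Nat.lt_floor_add_one (δ * m)
  set d := ⌊δ * m⌋₊ with hd_def
  have h1 := sum_pow_genus_le_prod_caps hy0.le (m := m) (fun r => if r ≤ d then 3 else 2) A hm (by
      intro S hS r h1 h2
      have hF := hF S hS
      have hm0 : (0 : ℝ) ≤ m := by positivity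
      have hr : (1 : ℝ) ≤ r := by exact_mod_cast h1
      have hm := hm S hS
      rw [hm] at hF
      split_ifs with h
      · refine S.kunz_le_of_frobenius_lt ?_
        have : (S.frobenius : ℝ) < r + 3 * m := by nlinarith
        rw [hm]
        exact_mod_cast this
      · refine S.kunz_le_of_frobenius_lt ?_
        have h3 : (d : ℝ) + 1 ≤ r := by exact_mod_cast (by omega : d + 1 ≤ r)
        have : (S.frobenius : ℝ) < r + 2 * m := by nlinarith
        rw [hm]
        exact_mod_cast this)
  refine h1.trans ?_
  have h2 : ∀ r ∈ Finset.range (m - 1),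
      ∑ j ∈ Finset.Icc 1 (if r + 1 ≤ d then 3 else 2), y ^ j ≤
        (if r < d then 2 else 1) * (y + y ^ 2) := by
    intro r _
    by_cases h : r + 1 ≤ d
    · rw [if_pos h, if_pos (by omega)]
      simp only [Finset.sum_Icc_succ_top, Nat.reduceLeDiff, Finset.Icc_self, Finset.sum_singleton]
      have h3 := pow_le_pow_of_le_one hy0.le hy1 (show 1 ≤ 3 by norm_num)
      norm_num at h3 ⊢
      nlinarith [sq_nonneg y]
    · rw [if_neg h, if_neg (by omega)]
      simp [Finset.sum_Icc_succ_top]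
  refine (Finset.prod_le_prod (fun _ _ => by positivity) h2).trans ?_
  rw [Finset.prod_mul_distrib, Finset.prod_const, Finset.card_range]
  refine mul_le_mul_of_nonneg_right ?_ (by positivity)
  calc ∏ r ∈ Finset.range (m - 1), (if r < d then (2 : ℝ) else 1)
      ≤ (2 : ℝ) ^ d := by
        rw [Finset.prod_ite, Finset.prod_const_one, mul_one, Finset.prod_const]
        refine pow_le_pow_right₀ (by norm_num) ?_
        refine (Finset.card_le_card (t := Finset.range d) fun r hr => ?_).trans_eq
          (Finset.card_range d)
        exact Finset.mem_range.2 (Finset.mem_filter.1 hr).2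
    _ = (2 : ℝ) ^ (d : ℝ) := (Real.rpow_natCast _ _).symm
    _ ≤ _ := Real.rpow_le_rpow_of_exponent_le (by norm_num) hd

/-- An exponential Chebyshev bound for semigroups of controlled Frobenius number: it suffices to
find a weight `y` at which the generating function is exponentially smaller. -/
theorem negligible_of_tilt {x y c δ D : ℝ} (hx0 : 0 < x) (hy0 : 0 < y) (hy1 : y ≤ 1)
    (hδ0 : 0 ≤ δ) (hδ1 : δ ≤ 1) (P : NumericalSemigroup → Prop)
    (hσ : (2 : ℝ) ^ δ * (x / y * (y + y ^ 2) ^ c) < 1)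
    (hP : ∀ S : NumericalSemigroup, P S → (S.frobenius : ℝ) < (2 + δ) * S.multiplicity ∧
      (y + y ^ 2) ^ (S.multiplicity - 1) ≤ D * (y + y ^ 2) ^ (c * S.genus)) :
    Negligible x P := by
  have hz : 0 < y + y ^ 2 := by positivity
  refine negligible_of_sum_le hx0.le (k := 1) (C := 2 ^ δ * |D|) (by positivity) hσ
    fun g hg A hA => ?_
  refine (sum_le_card_mul_of_fiber A multiplicity _
    (fun S hS => (hA S hS).1 ▸ S.multiplicity_mem_range) _
    (B := 2 ^ δ * |D| * (2 ^ δ * (x / y * (y + y ^ 2) ^ c)) ^ g)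
    fun m _ => ?_).trans_eq (by rw [Finset.card_range]; push_cast; ring)
  rcases (A.filter fun S => S.multiplicity = m).eq_empty_or_nonempty with h0 | ⟨T, hT⟩
  · rw [h0, Finset.sum_empty]; positivity
  have h1 := sum_pow_genus_le_of_frobenius_lt hy0 hy1 hδ0 hδ1
    (A.filter fun S => S.multiplicity = m) (fun S hS => (Finset.mem_filter.1 hS).2)
    (fun S hS => (hP S (hA S (Finset.mem_filter.1 hS).1).2).1)
  have h2 : ∑ S ∈ A with S.multiplicity = m, x ^ S.genus =
      (x / y) ^ g * ∑ S ∈ A with S.multiplicity = m, y ^ S.genus := by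
    rw [Finset.mul_sum]
    refine Finset.sum_congr rfl fun S hS => ?_
    rw [(hA S (Finset.mem_filter.1 hS).1).1, div_pow, div_mul_cancel₀]
    positivity
  obtain ⟨hT, hm⟩ := Finset.mem_filter.1 hT
  have h3 := (hP T (hA T hT).2).2
  have hmg := T.multiplicity_le_genus_add_one
  rw [(hA T hT).1] at h3 hmg
  rw [hm] at h3 hmg
  have h4 : (2 : ℝ) ^ (δ * m) ≤ 2 ^ (δ * g + δ) := by
    refine Real.rpow_le_rpow_of_exponent_le (by norm_num) ?_
    have : (m : ℝ) ≤ g + 1 := by exact_mod_cast hmg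
    nlinarith
  have h5 : (y + y ^ 2) ^ (m - 1) ≤ |D| * (y + y ^ 2) ^ (c * g) :=
    h3.trans (mul_le_mul_of_nonneg_right (le_abs_self D) (by positivity))
  rw [h2]
  calc (x / y) ^ g * ∑ S ∈ A with S.multiplicity = m, y ^ S.genus
      ≤ (x / y) ^ g * (2 ^ (δ * g + δ) * (|D| * (y + y ^ 2) ^ (c * g))) := by
        refine mul_le_mul_of_nonneg_left (h1.trans ?_) (by positivity)
        exact mul_le_mul h4 h5 (by positivity) (by positivity)
    _ = _ := by
        rw [Real.rpow_add (by norm_num), Real.rpow_mul_natCast (by norm_num),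
          Real.rpow_mul_natCast hz.le, mul_pow, mul_pow]
        ring

end NumericalSemigroup

theorem div_mul_rpow_lt_one {x y c : ℝ} (hx0 : 0 < x) (hx : x ^ 2 = 1 - x) (hy0 : 0 < y)
    (hc : 0 ≤ c) (h : (y - x) * (c * (1 + x + y) - y⁻¹) < 0) :
    x / y * (y + y ^ 2) ^ c < 1 := by
  have hz : 0 < y + y ^ 2 := by positivity
  rw [← Real.log_neg_iff (by positivity), Real.log_mul (by positivity) (by positivity),
    Real.log_rpow hz]
  have h1 := Real.log_le_sub_one_of_pos (show 0 < x / y by positivity)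
  have h2 := mul_le_mul_of_nonneg_left (Real.log_le_sub_one_of_pos hz) hc
  have h3 : x / y - 1 + c * (y + y ^ 2 - 1) = (y - x) * (c * (1 + x + y) - y⁻¹) := by
    have : x ^ 2 + x = 1 := by linarith
    field_simp
    linear_combination (c * y) * this
  linarith

theorem exists_rpow_mul_lt_one {σ ε : ℝ} (hσ : σ < 1) (hε : 0 < ε) :
    ∃ δ : ℝ, 0 < δ ∧ δ ≤ ε ∧ (2 : ℝ) ^ δ * σ < 1 := by
  have hcont : ContinuousAt (fun δ : ℝ => (2 : ℝ) ^ δ * σ) 0 :=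
    (Real.continuousAt_const_rpow (by norm_num)).mul continuousAt_const
  have h := hcont.eventually_lt_const (by simpa using hσ : (2 : ℝ) ^ (0 : ℝ) * σ < 1)
  obtain ⟨δ, h1, h2, h3⟩ := ((h.filter_mono nhdsWithin_le_nhds).and
    (Ioc_mem_nhdsGT hε)).exists
  exact ⟨δ, h2, h3, h1⟩

theorem exists_tilt {x c : ℝ} (hx0 : 0 < x) (hx1 : x < 1) (s : Set ℝ)
    [(𝓝[s] x).NeBot] (h : ∀ᶠ y in 𝓝[s] x, (y - x) * (c * (1 + x + y) - y⁻¹) < 0) :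
    ∃ y ∈ s, 0 < y ∧ y < 1 ∧ (y - x) * (c * (1 + x + y) - y⁻¹) < 0 := by
  have h1 : ∀ᶠ y in 𝓝[s] x, y ∈ Set.Ioo 0 1 :=
    nhdsWithin_le_nhds (Ioo_mem_nhds hx0 hx1)
  obtain ⟨y, ⟨h2, h3⟩, h4⟩ := ((h.and h1).and eventually_mem_nhdsWithin).exists
  exact ⟨y, h4, h3.1, h3.2, h2⟩

theorem continuousAt_tilt {x : ℝ} (hx0 : 0 < x) (c : ℝ) :
    ContinuousAt (fun y : ℝ => c * (1 + x + y) - y⁻¹) x := by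
  have := continuousAt_inv₀ hx0.ne'
  fun_prop

namespace NumericalSemigroup

theorem exists_negligible_of_multiplicity_le {x : ℝ} (hx0 : 0 < x) (hx : x ^ 2 = 1 - x)
    {c ε : ℝ} (hc0 : 0 ≤ c) (hc : c * (1 + 2 * x) < x⁻¹) (hε : 0 < ε) (hε1 : ε ≤ 1) :
    ∃ δ : ℝ, 0 < δ ∧ δ ≤ ε ∧ Negligible x (fun S =>
      (S.frobenius : ℝ) < (2 + δ) * S.multiplicity ∧ (S.multiplicity : ℝ) ≤ c * S.genus) := by
  obtain ⟨l, u⟩ := bounds_of_sq_eq hx0 hx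
  have hev : ∀ᶠ y in 𝓝[Set.Ioi x] x, (y - x) * (c * (1 + x + y) - y⁻¹) < 0 := by
    have := (continuousAt_tilt hx0 c).eventually_lt_const (u := 0) (by linarith)
    filter_upwards [this.filter_mono nhdsWithin_le_nhds, eventually_mem_nhdsWithin] with y h1 h2
    exact mul_neg_of_pos_of_neg (sub_pos.2 h2) h1
  obtain ⟨y, hxy, hy0, hy1, hy⟩ := exists_tilt hx0 (by linarith) _ hev
  have hxy : x < y := hxy
  obtain ⟨δ, hδ0, hδ1, hσ⟩ := exists_rpow_mul_lt_one (div_mul_rpow_lt_one hx0 hx hy0 hc0 hy) hε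
  refine ⟨δ, hδ0, hδ1, negligible_of_tilt (D := 1) hx0 hy0 hy1.le hδ0.le (hδ1.trans hε1) _ hσ
    fun S hS => ⟨hS.1, ?_⟩⟩
  have hz : 1 ≤ y + y ^ 2 := by nlinarith
  rw [one_mul, ← Real.rpow_natCast]
  refine Real.rpow_le_rpow_of_exponent_le hz (le_trans ?_ hS.2)
  exact_mod_cast Nat.sub_le _ _

theorem exists_negligible_of_le_multiplicity {x : ℝ} (hx0 : 0 < x) (hx : x ^ 2 = 1 - x)
    {c ε : ℝ} (hc0 : 0 ≤ c) (hc : x⁻¹ < c * (1 + 2 * x)) (hε : 0 < ε) (hε1 : ε ≤ 1) :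
    ∃ δ : ℝ, 0 < δ ∧ δ ≤ ε ∧ Negligible x (fun S =>
      (S.frobenius : ℝ) < (2 + δ) * S.multiplicity ∧ c * S.genus ≤ (S.multiplicity : ℝ)) := by
  obtain ⟨l, u⟩ := bounds_of_sq_eq hx0 hx
  have hev : ∀ᶠ y in 𝓝[Set.Iio x] x, (y - x) * (c * (1 + x + y) - y⁻¹) < 0 := by
    have := (continuousAt_tilt hx0 c).eventually_const_lt (u := 0) (by linarith)
    filter_upwards [this.filter_mono nhdsWithin_le_nhds, eventually_mem_nhdsWithin] with y h1 h2
    exact mul_neg_of_neg_of_pos (sub_neg.2 h2) h1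
  obtain ⟨y, hxy, hy0, hy1, hy⟩ := exists_tilt hx0 (by linarith) _ hev
  have hxy : y < x := hxy
  obtain ⟨δ, hδ0, hδ1, hσ⟩ := exists_rpow_mul_lt_one (div_mul_rpow_lt_one hx0 hx hy0 hc0 hy) hε
  have hz0 : 0 < y + y ^ 2 := by positivity
  refine ⟨δ, hδ0, hδ1, negligible_of_tilt (D := (y + y ^ 2) ^ (-1 : ℝ)) hx0 hy0 hy1.le hδ0.le
    (hδ1.trans hε1) _ hσ fun S hS => ⟨hS.1, ?_⟩⟩
  have hz : y + y ^ 2 ≤ 1 := by nlinarith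
  rw [← Real.rpow_add hz0, ← Real.rpow_natCast]
  refine Real.rpow_le_rpow_of_exponent_ge hz0 hz ?_
  rw [Nat.cast_sub S.multiplicity_pos]
  push_cast
  linarith [hS.2]

end NumericalSemigroup

namespace NumericalSemigroup

/-- The semigroup of multiplicity `p + 1` whose gaps are `1, …, p` together with `p + 2 + r` for
the `r ∈ B` below `p`. -/
def ofGaps (p : ℕ) (B : Finset ℕ) : NumericalSemigroup where
  carrier := {n | n = 0 ∨ p < n ∧ ∀ r ∈ B, r < p → n ≠ p + 2 + r}
  zero_mem := Or.inl rfl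
  add_mem := by
    rintro a b (rfl | ⟨ha, ha'⟩) (rfl | ⟨hb, hb'⟩)
    · exact Or.inl rfl
    · rw [zero_add]; exact Or.inr ⟨hb, hb'⟩
    · exact Or.inr ⟨ha, ha'⟩
    · exact Or.inr ⟨by omega, fun r _ hr => by omega⟩
  cofinite := by
    refine (Set.finite_Iio (2 * p + 2)).subset fun n hn => ?_
    rw [Set.mem_Iio]
    by_contra hc
    exact hn (Or.inr ⟨by omega, fun r _ hr => by omega⟩)

theorem mem_ofGaps {p : ℕ} {B : Finset ℕ} {n : ℕ} :
    n ∈ (ofGaps p B).carrier ↔ n = 0 ∨ p < n ∧ ∀ r ∈ B, r < p → n ≠ p + 2 + r := Iff.rfl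

theorem genus_ofGaps {p : ℕ} {B : Finset ℕ} (hB : B ⊆ Finset.range p) :
    (ofGaps p B).genus = p + B.card := by
  have h : (ofGaps p B).carrierᶜ = ↑(Finset.Icc 1 p ∪ B.image (fun r => p + 2 + r)) := by
    ext n
    simp only [Set.mem_compl_iff, mem_ofGaps, Finset.coe_union, Finset.coe_image, Set.mem_union,
      Finset.coe_Icc, Set.mem_Icc, Set.mem_image, Finset.mem_coe]
    constructor
    · intro hn
      by_contra hc
      push Not at hc
      refine hn ?_
      rcases Nat.eq_zero_or_pos n with h0 | h0
      · exact Or.inl h0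
      · exact Or.inr ⟨hc.1 h0, fun r hr _ => (hc.2 r hr).symm⟩
    · rintro (h | ⟨r, hr, rfl⟩) (h' | ⟨h1, h2⟩)
      · omega
      · omega
      · omega
      · exact h2 r hr (Finset.mem_range.1 (hB hr)) rfl
  rw [genus, h, Set.ncard_coe_finset, Finset.card_union_of_disjoint, Nat.card_Icc,
    Nat.add_sub_cancel, Finset.card_image_of_injective _ (add_right_injective _)]
  rw [Finset.disjoint_left]
  intro n hn hn'
  obtain ⟨r, -, rfl⟩ := Finset.mem_image.1 hn'
  have := (Finset.mem_Icc.1 hn).2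
  omega

theorem le_of_ofGaps_eq {p q : ℕ} {B C : Finset ℕ} (h : ofGaps p B = ofGaps q C) : q ≤ p := by
  by_contra hc
  have h1 : p + 1 ∈ (ofGaps p B).carrier := Or.inr ⟨by omega, fun r _ _ => by omega⟩
  rw [h, mem_ofGaps] at h1
  omega

theorem subset_of_ofGaps_eq {p : ℕ} {B C : Finset ℕ} (hB : B ⊆ Finset.range p)
    (h : ofGaps p B = ofGaps p C) : B ⊆ C := by
  intro r hr
  by_contra hc
  have h1 : p + 2 + r ∈ (ofGaps p C).carrier :=
    Or.inr ⟨by omega, fun s hs _ e => hc (by rwa [show r = s by omega])⟩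
  rw [← h, mem_ofGaps] at h1
  rcases h1 with h1 | ⟨-, h1⟩
  · omega
  · exact h1 r hr (Finset.mem_range.1 (hB hr)) rfl

theorem fib_le_ncard (g : ℕ) : Nat.fib (g + 1) ≤ {S : NumericalSemigroup | S.genus = g}.ncard := by
  have hcard : ((Finset.HasAntidiagonal.antidiagonal g).sigma
      fun p => Finset.powersetCard p.2 (Finset.range p.1)).card = Nat.fib (g + 1) := by
    simp [Nat.fib_succ_eq_sum_choose]
  rw [← hcard, Set.ncard_eq_toFinset_card _ (finite_genus_eq g)]
  refine Finset.card_le_card_of_injOn (fun p => ofGaps p.1.1 p.2) ?_ ?_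
  · rintro ⟨⟨p, q⟩, B⟩ h
    simp only [Finset.coe_sigma, Set.mem_sigma_iff, Finset.mem_coe, Finset.HasAntidiagonal.mem_antidiagonal,
      Finset.mem_powersetCard] at h
    simp [genus_ofGaps h.2.1, h.2.2, h.1]
  · rintro ⟨⟨p, q⟩, B⟩ h ⟨⟨p', q'⟩, B'⟩ h' e
    simp only [Finset.coe_sigma, Set.mem_sigma_iff, Finset.mem_coe, Finset.HasAntidiagonal.mem_antidiagonal,
      Finset.mem_powersetCard] at h h' e
    obtain rfl : p = p' := le_antisymm (le_of_ofGaps_eq e.symm) (le_of_ofGaps_eq e)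
    obtain rfl : q = q' := by omega
    obtain rfl : B = B' :=
      (subset_of_ofGaps_eq h.2.1 e).antisymm (subset_of_ofGaps_eq h'.2.1 e.symm)
    rfl

theorem one_le_pow_mul_fib {x : ℝ} (hx0 : 0 < x) (hx : x ^ 2 = 1 - x) (g : ℕ) :
    1 ≤ x ^ g * Nat.fib (g + 2) := by
  obtain ⟨l, u⟩ := bounds_of_sq_eq hx0 hx
  induction g using Nat.twoStepInduction with
  | zero => simp
  | one =>
    have : Nat.fib (1 + 2) = 2 := rfl
    rw [this]
    push_cast
    linarith
  | more g h1 h2 =>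
    rw [Nat.fib_add_two (n := g + 2)]
    push_cast
    calc (1 : ℝ) = x ^ 2 * 1 + x * 1 := by linarith
      _ ≤ x ^ 2 * (x ^ g * Nat.fib (g + 2)) + x * (x ^ (g + 1) * Nat.fib (g + 1 + 2)) := by gcongr
      _ = _ := by ring_nf

theorem one_le_two_mul_ncard_mul_pow {x : ℝ} (hx0 : 0 < x) (hx : x ^ 2 = 1 - x) (g : ℕ) :
    1 ≤ 2 * (({S : NumericalSemigroup | S.genus = g}.ncard : ℝ) * x ^ g) := by
  refine (one_le_pow_mul_fib hx0 hx g).trans ?_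
  have h : (Nat.fib (g + 2) : ℝ) ≤ 2 * {S : NumericalSemigroup | S.genus = g}.ncard := by
    have h1 := fib_le_ncard g
    have h2 : Nat.fib g ≤ Nat.fib (g + 1) := Nat.fib_le_fib_succ
    have h3 := Nat.fib_add_two (n := g)
    exact_mod_cast (by omega :
      Nat.fib (g + 2) ≤ 2 * {S : NumericalSemigroup | S.genus = g}.ncard)
  have := mul_le_mul_of_nonneg_left h (pow_nonneg hx0.le g)
  linarith

theorem tendsto_ncard_div_of_negligible {x : ℝ} (hx0 : 0 < x) (hx : x ^ 2 = 1 - x)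
    {P : NumericalSemigroup → Prop} (hP : Negligible x fun S => ¬ P S) :
    Tendsto (fun g : ℕ => ({S : NumericalSemigroup | S.genus = g ∧ P S}.ncard : ℝ) /
      ({S : NumericalSemigroup | S.genus = g}.ncard : ℝ)) atTop (𝓝 1) := by
  have hpos : ∀ g, (0 : ℝ) < {S : NumericalSemigroup | S.genus = g}.ncard := fun g => by
    have := fib_le_ncard g
    have h2 : 0 < Nat.fib (g + 1) := Nat.fib_pos.2 (by omega)
    exact_mod_cast (by omega : 0 < {S : NumericalSemigroup | S.genus = g}.ncard)
  have hsplit : ∀ g, ({S : NumericalSemigroup | S.genus = g ∧ P S}.ncard : ℝ) =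
      {S : NumericalSemigroup | S.genus = g}.ncard -
        {S : NumericalSemigroup | S.genus = g ∧ ¬ P S}.ncard := fun g => by
    have h := Set.ncard_union_eq
      (s := {S : NumericalSemigroup | S.genus = g ∧ P S})
      (t := {S : NumericalSemigroup | S.genus = g ∧ ¬ P S})
      (Set.disjoint_left.2 fun S h1 h2 => h2.2 h1.2)
      ((finite_genus_eq g).subset fun S hS => hS.1) ((finite_genus_eq g).subset fun S hS => hS.1)
    have e : {S : NumericalSemigroup | S.genus = g ∧ P S} ∪
        {S : NumericalSemigroup | S.genus = g ∧ ¬ P S} =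
        {S : NumericalSemigroup | S.genus = g} := by
      ext S
      simp only [Set.mem_union, Set.mem_ofPred_eq]
      tauto
    rw [e] at h
    rw [h]
    push_cast
    ring
  have h0 : Tendsto (fun g : ℕ => ({S : NumericalSemigroup | S.genus = g ∧ ¬ P S}.ncard : ℝ) /
      ({S : NumericalSemigroup | S.genus = g}.ncard : ℝ)) atTop (𝓝 0) := by
    have h2 := Tendsto.const_mul 2 hP
    rw [mul_zero] at h2
    refine squeeze_zero (fun g => by positivity) (fun g => ?_) h2
    rw [div_le_iff₀ (hpos g)]
    have := mul_le_mul_of_nonneg_left (one_le_two_mul_ncard_mul_pow hx0 hx g)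
      (Nat.cast_nonneg (α := ℝ) {S : NumericalSemigroup | S.genus = g ∧ ¬ P S}.ncard)
    linarith
  have h1 := (tendsto_const_nhds (x := (1 : ℝ))).sub h0
  rw [sub_zero] at h1
  refine h1.congr fun g => ?_
  rw [hsplit, sub_div, div_self (hpos g).ne']

end NumericalSemigroup

open NumericalSemigroup in
theorem portion_mult_and_frobenius (ε₁ ε₂ : ℝ) (hε₁ : 0 < ε₁) (hε₂ : 0 < ε₂) :
    Filter.Tendsto
      (fun g : ℕ =>
        (({S : NumericalSemigroup | S.genus = g ∧
            ((gamma - ε₁) * g < (S.multiplicity : ℝ) ∧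
              (S.multiplicity : ℝ) < (gamma + ε₁) * g) ∧
            ((2 - ε₂) * (S.multiplicity : ℝ) < (S.frobenius : ℝ) ∧
              (S.frobenius : ℝ) < (2 + ε₂) * (S.multiplicity : ℝ))}.ncard : ℝ)) /
          ({S : NumericalSemigroup | S.genus = g}.ncard : ℝ))
      Filter.atTop (nhds 1) := by
  have h5 : Real.sqrt 5 ^ 2 = 5 := Real.sq_sqrt (by norm_num)
  have h52 : 2 < Real.sqrt 5 := Real.lt_sqrt_of_sq_lt (by norm_num)
  obtain ⟨x, hxdef⟩ : ∃ x, x = (Real.sqrt 5 - 1) / 2 := ⟨_, rfl⟩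
  have hx0 : 0 < x := by rw [hxdef]; linarith
  have hx : x ^ 2 = 1 - x := by rw [hxdef]; linarith
  have hinv : x⁻¹ = gamma * (1 + 2 * x) := by
    refine inv_eq_of_mul_eq_one_right ?_
    rw [hxdef, gamma]
    linear_combination (Real.sqrt 5 + 4) / 20 * h5
  have hγ : 1 / 2 ≤ gamma := by rw [gamma]; linarith
  set e₁ := min ε₁ (1 / 2)
  set e₂ := min ε₂ 1
  have he₁ : 0 < e₁ := by positivity
  have he₁' : e₁ ≤ 1 / 2 := min_le_right _ _
  have he₁'' : e₁ ≤ ε₁ := min_le_left _ _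
  have he₂ : 0 < e₂ := by positivity
  have he₂' : e₂ ≤ 1 := min_le_right _ _
  have he₂'' : e₂ ≤ ε₂ := min_le_left _ _
  have h12 : 0 < e₁ * (1 + 2 * x) := by positivity
  obtain ⟨δ₁, h1, h1', hN1⟩ := exists_negligible_of_multiplicity_le hx0 hx (c := gamma - e₁)
    (by linarith) (by rw [hinv]; linarith) he₂ he₂'
  obtain ⟨δ₂, h2, h2', hN2⟩ := exists_negligible_of_le_multiplicity hx0 hx (c := gamma + e₁)
    (by linarith) (by rw [hinv]; linarith) he₂ he₂'
  have hN3 := negligible_of_small_frobenius hx0 hx he₂ he₂'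
  have hδ : 0 < min δ₁ δ₂ := lt_min h1 h2
  have hδ1 : min δ₁ δ₂ ≤ δ₁ := min_le_left _ _
  have hδ2 : min δ₁ δ₂ ≤ δ₂ := min_le_right _ _
  have hN4 := negligible_of_large_frobenius hx0 hx hδ (by linarith)
  have key : Tendsto (fun g : ℕ => ({S : NumericalSemigroup | S.genus = g ∧
        (((gamma - ε₁) * S.genus < (S.multiplicity : ℝ) ∧
          (S.multiplicity : ℝ) < (gamma + ε₁) * S.genus) ∧
        ((2 - ε₂) * (S.multiplicity : ℝ) < (S.frobenius : ℝ) ∧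
          (S.frobenius : ℝ) < (2 + ε₂) * (S.multiplicity : ℝ)))}.ncard : ℝ) /
      ({S : NumericalSemigroup | S.genus = g}.ncard : ℝ)) atTop (𝓝 1) := by
    refine tendsto_ncard_div_of_negligible hx0 hx
      (((hN1.or hx0.le hN2).or hx0.le (hN3.or hx0.le hN4)).mono hx0.le fun S hS hbad => ?_)
    contrapose! hbad
    obtain ⟨⟨hb1, hb2⟩, hb3, hb4⟩ := hbad
    have hm : (0 : ℝ) < S.multiplicity := by exact_mod_cast S.multiplicity_pos
    have hg : (0 : ℝ) ≤ S.genus := by positivity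
    have hF1 : (S.frobenius : ℝ) < (2 + δ₁) * S.multiplicity := hb4.trans_le (by gcongr)
    have hF2 : (S.frobenius : ℝ) < (2 + δ₂) * S.multiplicity := hb4.trans_le (by gcongr)
    have hm1 := hb1 hF1
    have hm2 := hb2 hF2
    refine ⟨⟨?_, ?_⟩, ?_, ?_⟩
    · exact lt_of_le_of_lt (by gcongr) hm1
    · exact hm2.trans_le (by gcongr)
    · exact lt_of_le_of_lt (by gcongr) hb3
    · exact hb4.trans_le (by gcongr; linarith)
  refine key.congr fun g => ?_
  congr 3
  ext S
  simp only [Set.mem_ofPred_eq]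
  constructor
  · rintro ⟨rfl, h⟩; exact ⟨rfl, h⟩
  · rintro ⟨rfl, h⟩; exact ⟨rfl, h⟩
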